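/- arXiv:0806.3366 — 6 statements merged into one kernel-verified Lean document; each statement's English description precedes it below -/
import Mathlib

section
/- Let n ≥ 1 be a natural number, let a₀ ≠ aₙ ∈ ℝ², and let 0 = t₀ < t₁ < ⋯ < tₙ = 1 determine points aᵢ := a₀ + tᵢ(aₙ − a₀). Let f : [a₀, aₙ] → ℝ² be affine on each subsegment [aᵢ, aᵢ₊₁] (i = 0, …, n−1). If the points f(a₀), …, f(aₙ) are pairwise distinct, then there exist a natural number m ≤ n, parameters 0 = s₀ < s₁ < ⋯ < s_m = 1 with points bᵢ := a₀ + sᵢ(aₙ − a₀), and an injective function g : [a₀, aₙ] → ℝ² that is affine on each [bᵢ, bᵢ₊₁], such that g(a₀) = f(a₀), g(aₙ) = f(aₙ), and g([a₀, aₙ]) ⊆ f([a₀, aₙ]). -/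
open Set Geometry EuclideanGeometry Metric Real

noncomputable section

abbrev E2 : Type := EuclideanSpace ℝ (Fin 2)

/-- The set of Hölder ratios of exponent `α` of `u` on `S`. -/
def holderRatioSet (α : ℝ) (S : Set E2) (u : E2 → E2) : Set ℝ :=
  {c | ∃ x ∈ S, ∃ y ∈ S, x ≠ y ∧ c = ‖u x - u y‖ / ‖x - y‖ ^ α}

/-- The Hölder seminorm of exponent `α` of `u` on `S`. -/
def holderSeminorm (α : ℝ) (S : Set E2) (u : E2 → E2) : ℝ :=
  sSup (holderRatioSet α S u)

/-- The supremum norm of `u` on `S`. -/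
def supNorm (S : Set E2) (u : E2 → E2) : ℝ :=
  sSup ((fun x => ‖u x‖) '' S)

/-- `f` is a homeomorphism of `S` onto its image `f '' S`. -/
def IsHomeoOn (f : E2 → E2) (S : Set E2) : Prop :=
  ContinuousOn f S ∧ Set.InjOn f S ∧ ContinuousOn (Function.invFunOn f S) (f '' S)

/-- `K` is a triangulation of `Ω`. -/
def IsTriangulation (K : SimplicialComplex ℝ E2) (Ω : Set E2) : Prop :=
  K.faces.Finite ∧ (∀ s ∈ K.faces, s.card ≤ 3) ∧ K.space = Ω ∧
    ∀ s ∈ K.faces, ∃ t ∈ K.faces, s ⊆ t ∧ t.card = 3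

/-- A closed polygon: a compact set admitting a triangulation. -/
def IsClosedPolygon (Ω : Set E2) : Prop :=
  IsCompact Ω ∧ ∃ K : SimplicialComplex ℝ E2, IsTriangulation K Ω

/-- `f` is piecewise affine over the simplicial complex `K`. -/
def PiecewiseAffineOn (f : E2 → E2) (K : SimplicialComplex ℝ E2) : Prop :=
  ∀ s ∈ K.faces, ∃ A : E2 →ᵃ[ℝ] E2, ∀ x ∈ convexHull ℝ (s : Set E2), f x = A x

/-- Every angle of every triangular face of `K` has sine at least `c`. -/
def AngleLB (K : SimplicialComplex ℝ E2) (c : ℝ) : Prop :=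
  ∀ s ∈ K.faces, ∀ p ∈ s, ∀ q ∈ s, ∀ r ∈ s,
    p ≠ q → q ≠ r → p ≠ r → c ≤ Real.sin (∠ p q r)

/-- Length of an edge (a two-element face). -/
def edgeLen (e : Finset E2) : ℝ := Metric.diam (e : Set E2)

/-- `o` is the incenter of the triangle `p₁p₂p₃` with inradius `r`. -/
def IsIncenter (p₁ p₂ p₃ o : E2) (r : ℝ) : Prop :=
  o ∈ interior (convexHull ℝ {p₁, p₂, p₃}) ∧
  Metric.infDist o (affineSpan ℝ ({p₁, p₂} : Set E2) : Set E2) = r ∧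
  Metric.infDist o (affineSpan ℝ ({p₂, p₃} : Set E2) : Set E2) = r ∧
  Metric.infDist o (affineSpan ℝ ({p₃, p₁} : Set E2) : Set E2) = r


/-- `h` restricted to `[0, L]` is an injective continuous path that is affine between consecutive
terms of `0 = s 0 < ⋯ < s m = L`. -/
structure IsPolygonalArc {E : Type*} [NormedAddCommGroup E] [NormedSpace ℝ E]
    (m : ℕ) (L : ℝ) (s : ℕ → ℝ) (h : ℝ → E) : Prop where
  zero : s 0 = 0
  last : s m = L
  lt : ∀ i j, i < j → j ≤ m → s i < s j
  affine : ∀ i < m, ∃ A : ℝ →ᵃ[ℝ] E, EqOn h A (Icc (s i) (s (i + 1)))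
  cont : ContinuousOn h (Icc 0 L)
  inj : InjOn h (Icc 0 L)

namespace IsPolygonalArc

variable {E : Type*} [NormedAddCommGroup E] [NormedSpace ℝ E]
  {m : ℕ} {L : ℝ} {s : ℕ → ℝ} {h : ℝ → E}

lemma le (H : IsPolygonalArc m L s h) {i j : ℕ} (hij : i ≤ j) (hj : j ≤ m) : s i ≤ s j := by
  rcases hij.eq_or_lt with rfl | hlt
  · exact le_rfl
  · exact (H.lt i j hlt hj).le

lemma nonneg (H : IsPolygonalArc m L s h) : 0 ≤ L := by
  rw [← H.zero, ← H.last]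
  exact H.le (Nat.zero_le m) le_rfl

lemma truncate (H : IsPolygonalArc m L s h) {c : ℝ} (hc : c ∈ Icc 0 L) :
    ∃ i ≤ m, IsPolygonalArc i c (fun j => min (s j) c) h := by
  classical
  have hex : ∃ i, c ≤ s i := ⟨m, by rw [H.last]; exact hc.2⟩
  have him : Nat.find hex ≤ m := Nat.find_min' hex (by rw [H.last]; exact hc.2)
  have hlt : ∀ j < Nat.find hex, s j < c := fun j hj => not_le.1 (Nat.find_min hex hj)
  refine ⟨Nat.find hex, him, ?_, ?_, ?_, ?_, ?_, ?_⟩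
  · simp [H.zero, hc.1]
  · exact min_eq_right (Nat.find_spec hex)
  · intro i j hij hj
    have hi := hlt i (hij.trans_le hj)
    exact lt_min ((min_le_left _ _).trans_lt (H.lt i j hij (hj.trans him)))
      ((min_le_left _ _).trans_lt hi)
  · intro i hi
    obtain ⟨A, hA⟩ := H.affine i (hi.trans_le him)
    refine ⟨A, hA.mono (Icc_subset_Icc ?_ (min_le_left _ _))⟩
    exact le_min le_rfl (hlt i hi).le
  · exact H.cont.mono (Icc_subset_Icc_right hc.2)
  · exact H.inj.mono (Icc_subset_Icc_right hc.2)

lemma snoc (H : IsPolygonalArc m L s h) {y : E}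
    (hy : ∀ u ∈ Ioc (0 : ℝ) 1, AffineMap.lineMap (h L) y u ∉ h '' Icc 0 L) :
    ∃ s' h', IsPolygonalArc (m + 1) (L + 1) s' h' ∧ EqOn h' h (Icc 0 L) ∧
      EqOn h' (fun x => AffineMap.lineMap (h L) y (x - L)) (Icc L (L + 1)) := by
  have hL := H.nonneg
  have hne : h L ≠ y := by
    rintro rfl
    exact hy 1 (by simp) (by simpa using ⟨L, ⟨hL, le_rfl⟩, rfl⟩)
  set B : ℝ →ᵃ[ℝ] E := (AffineMap.lineMap (h L) y).comp
    (AffineMap.id ℝ ℝ - AffineMap.const ℝ ℝ L) with hB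
  have hBx : ∀ x, B x = AffineMap.lineMap (h L) y (x - L) := fun x => by simp [hB]
  set h' : ℝ → E := fun x => if x ≤ L then h x else B x with hh'
  have e1 : EqOn h' h (Icc 0 L) := fun x hx => by simp [hh', hx.2]
  have e2 : EqOn h' B (Icc L (L + 1)) := by
    intro x hx
    by_cases hxL : x ≤ L
    · obtain rfl : x = L := le_antisymm hxL hx.1
      simp [hh', hBx]
    · simp [hh', hxL]
  have hunion : Icc 0 L ∪ Icc L (L + 1) = Icc 0 (L + 1) :=
    Icc_union_Icc_eq_Icc hL (by linarith)
  have hcross : ∀ x ∈ Icc 0 L, ∀ z ∈ Ioc L (L + 1), h' x ≠ h' z := by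
    intro x hx z hz heq
    refine hy (z - L) ⟨by linarith [hz.1], by linarith [hz.2]⟩ ⟨x, hx, ?_⟩
    rw [← e1 hx, heq, e2 ⟨hz.1.le, hz.2⟩, hBx]
  refine ⟨fun j => if j ≤ m then s j else L + 1, h', ⟨?_, ?_, ?_, ?_, ?_, ?_⟩, e1, ?_⟩
  · simp [H.zero]
  · simp
  · intro i j hij hj
    have him : i ≤ m := by omega
    by_cases hjm : j ≤ m
    · simpa [him, hjm] using H.lt i j hij hjm
    · have := H.le him le_rfl
      rw [H.last] at this
      simp only [him, hjm, if_true, if_false]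
      linarith
  · intro i hi
    rcases (Nat.lt_succ_iff.1 hi).eq_or_lt with rfl | hlt
    · exact ⟨B, by simpa [H.last] using e2⟩
    · obtain ⟨A, hA⟩ := H.affine i hlt
      refine ⟨A, ?_⟩
      simp only [hlt.le, Nat.succ_le_of_lt hlt, if_true]
      have hsub : Icc (s i) (s (i + 1)) ⊆ Icc 0 L :=
        Icc_subset_Icc (H.zero ▸ H.le (Nat.zero_le i) hlt.le) (H.last ▸ H.le hlt le_rfl)
      exact (e1.mono hsub).trans hA
  · rw [← hunion]
    refine ContinuousOn.union_of_isClosed (H.cont.congr e1) ?_ isClosed_Icc isClosed_Icc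
    refine ContinuousOn.congr ?_ (e2.trans fun x _ => hBx x)
    exact (AffineMap.lineMap_continuous.comp (continuous_id.sub continuous_const)).continuousOn
  · intro x hx z hz heq
    rcases le_or_gt x L with hxL | hxL <;> rcases le_or_gt z L with hzL | hzL
    · exact H.inj ⟨hx.1, hxL⟩ ⟨hz.1, hzL⟩ (by rwa [e1 ⟨hx.1, hxL⟩, e1 ⟨hz.1, hzL⟩] at heq)
    · exact (hcross x ⟨hx.1, hxL⟩ z ⟨hzL, hz.2⟩ heq).elim
    · exact (hcross z ⟨hz.1, hzL⟩ x ⟨hxL, hx.2⟩ heq.symm).elim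
    · rw [e2 ⟨hxL.le, hx.2⟩, e2 ⟨hzL.le, hz.2⟩, hBx, hBx] at heq
      linarith [AffineMap.lineMap_injective ℝ hne heq]
  · exact e2.trans fun x _ => hBx x

/-- Any point can be reached from the end of a polygonal arc by adding a straight segment and
cutting off the loop which this creates. -/
lemma extend (H : IsPolygonalArc m L s h) (y : E) :
    ∃ m' ≤ m + 1, ∃ L' s' h', IsPolygonalArc m' L' s' h' ∧ h' 0 = h 0 ∧ h' L' = y ∧
      h' '' Icc 0 L' ⊆ h '' Icc 0 L ∪ segment ℝ (h L) y := by
  have hline : Continuous (AffineMap.lineMap (h L) y : ℝ → E) := AffineMap.lineMap_continuous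
  have hK : IsCompact (Icc (0 : ℝ) 1 ∩ AffineMap.lineMap (h L) y ⁻¹' (h '' Icc 0 L)) :=
    isCompact_Icc.inter_right ((isCompact_Icc.image_of_continuousOn H.cont).isClosed.preimage hline)
  obtain ⟨u, ⟨hu, c, hc, hcu⟩, hmax⟩ := hK.exists_isGreatest
    ⟨0, by simp, by simpa using ⟨L, ⟨H.nonneg, le_rfl⟩, rfl⟩⟩
  obtain ⟨i, him, Hi⟩ := H.truncate hc
  have hsub : h '' Icc 0 c ⊆ h '' Icc 0 L := image_mono (Icc_subset_Icc_right hc.2)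
  rcases hu.2.eq_or_lt with rfl | hu1
  · exact ⟨i, by omega, c, _, h, Hi, rfl, by simpa using hcu, hsub.trans subset_union_left⟩
  have hrepar : ∀ v : ℝ, AffineMap.lineMap (h c) y v =
      AffineMap.lineMap (h L) y (u + v * (1 - u)) := by
    intro v
    rw [hcu]
    simp only [AffineMap.lineMap_apply_module]
    module
  obtain ⟨s', h', H', e1, e2⟩ := Hi.snoc (y := y) (by
    intro v hv hmem
    rw [hrepar] at hmem
    have := hmax ⟨⟨by nlinarith [hu.1, hv.1], by nlinarith [hv.2]⟩, hsub hmem⟩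
    nlinarith [hv.1])
  refine ⟨i + 1, by omega, c + 1, s', h', H', e1 ⟨le_rfl, hc.1⟩, ?_, ?_⟩
  · simpa using e2 (x := c + 1) ⟨by linarith, le_rfl⟩
  · rintro _ ⟨x, hx, rfl⟩
    rcases le_total x c with hxc | hxc
    · exact Or.inl (hsub ⟨x, ⟨hx.1, hxc⟩, (e1 ⟨hx.1, hxc⟩).symm⟩)
    · right
      rw [e2 ⟨hxc, hx.2⟩, segment_eq_image_lineMap]
      have hx2 := hx.2
      refine ⟨u + (x - c) * (1 - u), ⟨?_, ?_⟩, (hrepar _).symm⟩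
      · nlinarith [hu.1]
      · nlinarith

end IsPolygonalArc

/-- A chain of `n` segments contains a polygonal arc with at most `n` pieces and the same
endpoints. -/
lemma exists_isPolygonalArc_of_chain {E : Type*} [NormedAddCommGroup E] [NormedSpace ℝ E]
    (P : ℕ → E) (S : Set E) (h0 : P 0 ∈ S) (n : ℕ)
    (hP : ∀ i < n, segment ℝ (P i) (P (i + 1)) ⊆ S) :
    ∃ m ≤ n, ∃ L s h, IsPolygonalArc m L s h ∧ h 0 = P 0 ∧ h L = P n ∧ h '' Icc 0 L ⊆ S := by
  induction n with
  | zero =>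
    refine ⟨0, le_rfl, 0, fun _ => 0, fun _ => P 0,
      ⟨rfl, rfl, by omega, by omega, continuousOn_const, by simp⟩, rfl, rfl, ?_⟩
    rintro _ ⟨x, -, rfl⟩
    exact h0
  | succ n ih =>
    obtain ⟨m, hm, L, s, h, H, h1, h2, h3⟩ := ih fun i hi => hP i (by omega)
    obtain ⟨m', hm', L', s', h', H', h1', h2', h3'⟩ := H.extend (P (n + 1))
    refine ⟨m', by omega, L', s', h', H', h1'.trans h1, h2', h3'.trans (union_subset h3 ?_)⟩
    rw [h2]
    exact hP n (by omega)

/-- Any multiple of the parameter along a nondegenerate segment extends to an affine functional. -/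
lemma exists_affineMap_eq_mul_parameter {E : Type*} [NormedAddCommGroup E]
    [InnerProductSpace ℝ E] {a b : E} (hab : a ≠ b) (L : ℝ) :
    ∃ φ : E →ᵃ[ℝ] ℝ, ∀ τ : ℝ, φ (a + τ • (b - a)) = L * τ := by
  have hd : inner ℝ (b - a) (b - a) ≠ 0 := inner_self_ne_zero.2 (sub_ne_zero.2 hab.symm)
  refine ⟨(((L / inner ℝ (b - a) (b - a)) • innerₛₗ ℝ (b - a)).toAffineMap.comp
    (AffineMap.id ℝ E - AffineMap.const ℝ E a)), fun τ => ?_⟩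
  simp only [AffineMap.comp_apply, AffineMap.coe_sub, Pi.sub_apply, AffineMap.id_apply,
    AffineMap.const_apply, LinearMap.coe_toAffineMap, LinearMap.smul_apply, innerₛₗ_apply_apply,
    add_sub_cancel_left, inner_smul_right, smul_eq_mul]
  field_simp

/-- removing loops from a piecewise affine curve with distinct nodal
values produces an injective piecewise affine map with the same endpoints and
image contained in the original image. -/
theorem statement3 (n : ℕ) (hn : 1 ≤ n) (a0 an : E2) (hne : a0 ≠ an)
    (t : ℕ → ℝ) (ht0 : t 0 = 0) (htn : t n = 1)
    (htmono : ∀ i j, i < j → j ≤ n → t i < t j)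
    (f : E2 → E2)
    (hf : ∀ i < n, ∃ A : E2 →ᵃ[ℝ] E2,
      ∀ x ∈ segment ℝ (a0 + t i • (an - a0)) (a0 + t (i + 1) • (an - a0)), f x = A x)
    (hdist : ∀ i ≤ n, ∀ j ≤ n, i ≠ j →
      f (a0 + t i • (an - a0)) ≠ f (a0 + t j • (an - a0))) :
    ∃ m ≤ n, ∃ s : ℕ → ℝ, s 0 = 0 ∧ s m = 1 ∧ (∀ i j, i < j → j ≤ m → s i < s j) ∧
      ∃ g : E2 → E2, Set.InjOn g (segment ℝ a0 an) ∧
        (∀ i < m, ∃ A : E2 →ᵃ[ℝ] E2,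
          ∀ x ∈ segment ℝ (a0 + s i • (an - a0)) (a0 + s (i + 1) • (an - a0)), g x = A x) ∧
        g a0 = f a0 ∧ g an = f an ∧ g '' segment ℝ a0 an ⊆ f '' segment ℝ a0 an := by
  have htm : ∀ i ≤ n, t i ∈ Icc (0 : ℝ) 1 := by
    intro i hi
    constructor
    · rcases Nat.eq_zero_or_pos i with rfl | h
      · exact ht0.ge
      · exact ht0 ▸ (htmono 0 i h hi).le
    · rcases hi.eq_or_lt with rfl | h
      · exact htn.le
      · exact htn ▸ (htmono i n h le_rfl).le
  have hmem : ∀ τ ∈ Icc (0 : ℝ) 1, a0 + τ • (an - a0) ∈ segment ℝ a0 an := fun τ hτ => by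
    rw [segment_eq_image']
    exact ⟨τ, hτ, rfl⟩
  obtain ⟨m, hm, L, s, h, H, h1, h2, h3⟩ := exists_isPolygonalArc_of_chain
    (fun i => f (a0 + t i • (an - a0))) (f '' segment ℝ a0 an)
    ⟨_, hmem _ (htm 0 (Nat.zero_le n)), rfl⟩ n (by
      intro i hi
      obtain ⟨A, hA⟩ := hf i hi
      rw [hA _ (left_mem_segment ℝ _ _), hA _ (right_mem_segment ℝ _ _), ← image_segment,
        ← image_congr hA]
      exact image_mono ((convex_segment a0 an).segment_subset (hmem _ (htm i hi.le))
        (hmem _ (htm (i + 1) hi))))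
  have hL : 0 < L := by
    refine H.nonneg.lt_of_ne ?_
    rintro rfl
    exact hdist 0 (Nat.zero_le n) n le_rfl (by omega) (h1.symm.trans h2)
  obtain ⟨φ, hφ⟩ := exists_affineMap_eq_mul_parameter hne L
  have hg0 : φ a0 = 0 := by simpa using hφ 0
  have hg1 : φ an = L := by simpa using hφ 1
  have hmaps : MapsTo φ (segment ℝ a0 an) (Icc 0 L) := by
    rw [mapsTo_iff_image_subset, image_segment, hg0, hg1, segment_eq_Icc hL.le]
  refine ⟨m, hm, fun i => s i / L, by simp [H.zero], by simp [H.last, hL.ne'], ?_,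
    h ∘ φ, ?_, ?_, ?_, ?_, ?_⟩
  · exact fun i j hij hj => div_lt_div_of_pos_right (H.lt i j hij hj) hL
  · refine H.inj.comp ?_ hmaps
    rw [segment_eq_image']
    rintro _ ⟨x, -, rfl⟩ _ ⟨y, -, rfl⟩ hxy
    simp only [hφ] at hxy
    rw [mul_left_cancel₀ hL.ne' hxy]
  · intro i hi
    obtain ⟨A, hA⟩ := H.affine i hi
    refine ⟨A.comp φ, fun x hx => hA ?_⟩
    have hx' := mem_image_of_mem φ hx
    rwa [image_segment, hφ, hφ, mul_div_cancel₀ _ hL.ne', mul_div_cancel₀ _ hL.ne',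
      segment_eq_Icc (H.lt i (i + 1) i.lt_succ_self hi).le] at hx'
  · simp [hg0, h1, ht0]
  · simp [hg1, h2, htn]
  · rw [image_comp]
    exact (image_mono hmaps.image_subset).trans h3

end
end

section
/- Let Δ ⊂ ℝ² be a (closed, nondegenerate) triangle with incenter o and inradius r, let 0 < h < r, and let a₀, …, a_{w−1} be pairwise distinct points of ∂Δ (with a_w := a₀). For each k, let b_k be the unique point of the segment [a_k, o] with ‖b_k − o‖ = h. Then: (i) the convex hull of {b₀, …, b_{w−1}} is contained in the interior of Δ; (ii) each b_k is an extreme point of the convex hull of {b₀, …, b_{w−1}}; and (iii) for each k such that a_k and a_{k+1} lie on a common side of Δ, the four points a_k, a_{k+1}, b_{k+1}, b_k are in convex position, i.e. each of them is an extreme point of the convex hull of the four. -/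
open Set Geometry EuclideanGeometry Metric Real

noncomputable section

theorem mem_extremePoints_convexHull_of_forall_lt {V : Type*} [AddCommGroup V] [Module ℝ V]
    {S : Set V} {x : V} (hx : x ∈ S) (f : V →ₗ[ℝ] ℝ) (hf : ∀ y ∈ S, y ≠ x → f x < f y) :
    x ∈ (convexHull ℝ S).extremePoints ℝ := by
  have hconv : Convex ℝ {y | y = x ∨ f x < f y} := by
    rintro y (rfl | hy) z (rfl | hz) s t hs ht hst
    · exact Or.inl (by rw [← add_smul, hst, one_smul])
    all_goals
      simp only [mem_ofPred_eq, map_add, map_smul, smul_eq_mul]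
    · rcases ht.eq_or_lt with rfl | ht
      · left
        simp_all
      · right
        obtain rfl : s = 1 - t := by linarith
        nlinarith
    · rcases hs.eq_or_lt with rfl | hs
      · left
        simp_all
      · right
        obtain rfl : t = 1 - s := by linarith
        nlinarith
    · right
      obtain rfl : t = 1 - s := by linarith
      rcases hs.eq_or_lt with rfl | hs
      · simpa using hz
      · nlinarith
  have hsub : convexHull ℝ S ⊆ {y | y = x ∨ f x < f y} :=
    convexHull_min (fun y hy => or_iff_not_imp_left.2 (hf y hy)) hconv
  refine ⟨subset_convexHull ℝ S hx, ?_⟩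
  rintro y hy z hz ⟨s, t, hs, ht, hst, hxyz⟩
  by_contra hne
  have hy' : f x < f y := (hsub hy).resolve_left hne
  have hz' : f x ≤ f z := (hsub hz).elim (fun e => e ▸ le_rfl) le_of_lt
  have key := congrArg f hxyz
  simp only [map_add, map_smul, smul_eq_mul] at key
  obtain rfl : t = 1 - s := by linarith
  nlinarith

theorem mem_extremePoints_convexHull_of_subset_sphere {V : Type*} [NormedAddCommGroup V]
    [InnerProductSpace ℝ V] {S : Set V} {o x : V} {h : ℝ} (hS : S ⊆ sphere o h) (hx : x ∈ S) :
    x ∈ (convexHull ℝ S).extremePoints ℝ := by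
  refine mem_extremePoints_convexHull_of_forall_lt hx (-(innerₛₗ ℝ (x - o))) fun y hy hyx => ?_
  have h1 : ‖x - o‖ = h := by simpa [dist_eq_norm] using hS hx
  have h2 : ‖y - o‖ = h := by simpa [dist_eq_norm] using hS hy
  have h3 : 0 < ‖(x - o) - (y - o)‖ := by
    simpa [sub_eq_zero] using hyx.symm
  have h4 := norm_sub_sq_real (x - o) (y - o)
  have h5 : inner ℝ (x - o) x - inner ℝ (x - o) y
      = inner ℝ (x - o) (x - o) - inner ℝ (x - o) (y - o) := by
    simp only [inner_sub_right]
    ring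
  rw [real_inner_self_eq_norm_sq] at h5
  simp only [LinearMap.neg_apply, innerₛₗ_apply_apply]
  rw [h1, h2] at h4
  rw [h1] at h5
  nlinarith [pow_pos h3 2]

/-- A quadrilateral with two vertices `o + u`, `o + v` and the other two strictly between
these and `o` is in convex position. -/
theorem mem_extremePoints_convexHull_of_rays {V : Type*} [AddCommGroup V] [Module ℝ V]
    {o a a' b b' : V} {s t : ℝ} (ht0 : 0 < t) (ht1 : t < 1) (hs0 : 0 < s) (hs1 : s < 1)
    (hb : b - o = t • (a - o)) (hb' : b' - o = s • (a' - o))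
    (hf : ∀ p q : ℝ, ∃ f : V →ₗ[ℝ] ℝ, f (a - o) = p ∧ f (a' - o) = q)
    {x : V} (hx : x ∈ ({a, a', b', b} : Set V)) :
    x ∈ (convexHull ℝ ({a, a', b', b} : Set V)).extremePoints ℝ := by
  have main : ∀ p q : ℝ, ∃ f : V →ₗ[ℝ] ℝ, f a = f o + p ∧ f a' = f o + q ∧
      f b = f o + t * p ∧ f b' = f o + s * q := by
    intro p q
    obtain ⟨f, h1, h2⟩ := hf p q
    have h3 := congrArg f hb
    have h4 := congrArg f hb'
    rw [map_smul, h1, map_sub, smul_eq_mul] at h3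
    rw [map_smul, h2, map_sub, smul_eq_mul] at h4
    rw [map_sub] at h1 h2
    exact ⟨f, by linarith, by linarith, by linarith, by linarith⟩
  have ht2 : 1 < t⁻¹ := (one_lt_inv₀ ht0).2 ht1
  have hs2 : 1 < s⁻¹ := (one_lt_inv₀ hs0).2 hs1
  have ht3 : t * t⁻¹ = 1 := mul_inv_cancel₀ ht0.ne'
  have hs3 : s * s⁻¹ = 1 := mul_inv_cancel₀ hs0.ne'
  have hx' := hx
  rcases hx' with rfl | rfl | rfl | rfl
  · obtain ⟨f, h1, h2, h3, h4⟩ := main (-1) (-1 / 2)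
    refine mem_extremePoints_convexHull_of_forall_lt hx f ?_
    rintro y (rfl | rfl | rfl | rfl) hne <;> first | exact absurd rfl hne | linarith
  · obtain ⟨f, h1, h2, h3, h4⟩ := main (-1 / 2) (-1)
    refine mem_extremePoints_convexHull_of_forall_lt hx f ?_
    rintro y (rfl | rfl | rfl | rfl) hne <;> first | exact absurd rfl hne | linarith
  · obtain ⟨f, h1, h2, h3, h4⟩ := main (2 * t⁻¹) s⁻¹
    refine mem_extremePoints_convexHull_of_forall_lt hx f ?_
    rintro y (rfl | rfl | rfl | rfl) hne <;> first | exact absurd rfl hne | linarith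
  · obtain ⟨f, h1, h2, h3, h4⟩ := main t⁻¹ (2 * s⁻¹)
    refine mem_extremePoints_convexHull_of_forall_lt hx f ?_
    rintro y (rfl | rfl | rfl | rfl) hne <;> first | exact absurd rfl hne | linarith

theorem mem_extremePoints_convexHull_pair {V : Type*} [AddCommGroup V] [Module ℝ V]
    {o a b : V} {t : ℝ} (ht1 : t < 1) (hb : b - o = t • (a - o))
    (f : V →ₗ[ℝ] ℝ) (hf : f a < f o)
    {x : V} (hx : x ∈ ({a, b} : Set V)) :
    x ∈ (convexHull ℝ ({a, b} : Set V)).extremePoints ℝ := by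
  have hfb : f a < f b := by
    have := congrArg f hb
    simp only [map_sub, map_smul, smul_eq_mul] at this
    nlinarith
  have hx' := hx
  rcases hx' with rfl | rfl
  · refine mem_extremePoints_convexHull_of_forall_lt hx f ?_
    rintro y (rfl | rfl) hne
    exacts [absurd rfl hne, hfb]
  · refine mem_extremePoints_convexHull_of_forall_lt hx (-f) ?_
    rintro y (rfl | rfl) hne
    exacts [neg_lt_neg hfb, absurd rfl hne]

/-- If two distinct vectors have the same nonzero value under some linear functional, then
linear functionals take arbitrary pairs of values on them. -/
theorem exists_linearMap_apply_eq {V : Type*} [NormedAddCommGroup V] [InnerProductSpace ℝ V]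
    {u v : V} (huv : u ≠ v) (g : V →ₗ[ℝ] ℝ) (hg : g u = g v) (hg0 : g u ≠ 0) (p q : ℝ) :
    ∃ f : V →ₗ[ℝ] ℝ, f u = p ∧ f v = q := by
  have hd : inner ℝ (u - v) (u - v) ≠ 0 := inner_self_ne_zero.2 (sub_ne_zero.2 huv)
  have hsub : inner ℝ (u - v) u = inner ℝ (u - v) v + inner ℝ (u - v) (u - v) := by
    rw [← inner_add_right, add_sub_cancel]
  set d := inner ℝ (u - v) (u - v)
  set m := inner ℝ (u - v) v
  refine ⟨((p - q) / d) • innerₛₗ ℝ (u - v) + ((q - (p - q) / d * m) / g u) • g, ?_, ?_⟩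
  · simp only [LinearMap.add_apply, LinearMap.smul_apply, innerₛₗ_apply_apply, smul_eq_mul, hsub]
    field_simp
    ring
  · simp only [LinearMap.add_apply, LinearMap.smul_apply, innerₛₗ_apply_apply, smul_eq_mul, ← hg]
    field_simp
    ring

theorem coord_eq_zero_of_mem_segment {ι V : Type*} [AddCommGroup V] [Module ℝ V]
    (B : AffineBasis ι ℝ V) {i j k : ι} (hj : i ≠ j) (hk : i ≠ k) {x : V}
    (hx : x ∈ segment ℝ (B j) (B k)) : B.coord i x = 0 := by
  rw [segment_eq_image_lineMap] at hx
  obtain ⟨t, -, rfl⟩ := hx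
  rw [AffineMap.apply_lineMap, B.coord_apply_ne hj, B.coord_apply_ne hk,
    AffineMap.lineMap_same_apply]

theorem sum_fin_three_eq_add_shift {W : Type*} [AddCommGroup W] (i : Fin 3) (f : Fin 3 → W) :
    ∑ j, f j = f i + (f (i + 1) + f (i + 2)) := by
  rw [Fin.sum_univ_three]
  fin_cases i <;> simp <;> abel

theorem mem_affineSpan_pair_of_coord_eq_zero {V : Type*} [AddCommGroup V] [Module ℝ V]
    (B : AffineBasis (Fin 3) ℝ V) (i : Fin 3) {x : V} (hx : B.coord i x = 0) :
    x ∈ affineSpan ℝ {B (i + 1), B (i + 2)} := by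
  have h1 := B.sum_coord_apply_eq_one x
  have h2 := B.linear_combination_coord_eq_self x
  rw [sum_fin_three_eq_add_shift i, hx, zero_add] at h1
  rw [sum_fin_three_eq_add_shift i, hx, zero_smul, zero_add, eq_sub_of_add_eq h1,
    ← AffineMap.lineMap_apply_module] at h2
  rw [← h2]
  exact AffineMap.lineMap_mem_affineSpan_pair _ _ _

theorem exists_coord_eq_zero_of_mem_frontier {ι V : Type*} [Finite ι] [NormedAddCommGroup V]
    [NormedSpace ℝ V] (B : AffineBasis ι ℝ V) {x : V}
    (hx : x ∈ frontier (convexHull ℝ (range B))) : ∃ i, B.coord i x = 0 := by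
  have hc : IsClosed (convexHull ℝ (range B)) := (finite_range B).isClosed_convexHull ℝ
  rw [hc.frontier_eq, B.interior_convexHull, B.convexHull_eq_nonneg_coord] at hx
  by_contra! hne
  exact hx.2 fun i => (hx.1 i).lt_of_ne (hne i).symm

theorem ball_subset_interior_of_forall_mem_frontier {V : Type*} [NormedAddCommGroup V]
    [NormedSpace ℝ V] {S : Set V} {o : V} {r : ℝ} (hr : 0 < r) (ho : o ∈ interior S)
    (hd : ∀ x ∈ frontier S, r ≤ dist x o) : ball o r ⊆ interior S := by
  refine (convex_ball o r).isPreconnected.subset_left_of_subset_union isOpen_interior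
    isClosed_closure.isOpen_compl
    (disjoint_compl_right.mono_left (interior_subset.trans subset_closure)) (fun x hx => ?_)
    ⟨o, mem_ball_self hr, ho⟩
  by_contra hx'
  rw [mem_union, mem_compl_iff, not_or, not_not] at hx'
  exact (hd x ⟨hx'.2, hx'.1⟩).not_gt hx

/-- the inner points `b_k` form a convex polygon inside the triangle,
each `b_k` is an extreme point, and consecutive quadrilaterals are in convex position. -/
theorem statement7 (p₁ p₂ p₃ : E2) (hind : AffineIndependent ℝ ![p₁, p₂, p₃])
    (Δ : Set E2) (hΔ : Δ = convexHull ℝ {p₁, p₂, p₃})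
    (o : E2) (r : ℝ) (hinc : IsIncenter p₁ p₂ p₃ o r)
    (h : ℝ) (hh0 : 0 < h) (hhr : h < r)
    (w : ℕ) (hw : 0 < w) (a b : ℕ → E2)
    (haΔ : ∀ k < w, a k ∈ frontier Δ)
    (hane : ∀ i < w, ∀ j < w, i ≠ j → a i ≠ a j)
    (haw : a w = a 0) (hbw : b w = b 0)
    (hb : ∀ k < w, b k ∈ segment ℝ (a k) o ∧ dist (b k) o = h) :
    convexHull ℝ (b '' Set.Iio w) ⊆ interior Δ ∧
    (∀ k < w, b k ∈ Set.extremePoints ℝ (convexHull ℝ (b '' Set.Iio w))) ∧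
    (∀ k < w,
      (∃ s ∈ ({segment ℝ p₁ p₂, segment ℝ p₂ p₃, segment ℝ p₃ p₁} : Set (Set E2)),
        a k ∈ s ∧ a (k + 1) ∈ s) →
      ∀ x ∈ ({a k, a (k + 1), b (k + 1), b k} : Set E2),
        x ∈ Set.extremePoints ℝ
          (convexHull ℝ ({a k, a (k + 1), b (k + 1), b k} : Set E2))) := by
  obtain ⟨ho, hd12, hd23, hd31⟩ := hinc
  have htop : affineSpan ℝ (range ![p₁, p₂, p₃]) = ⊤ :=
    hind.affineSpan_eq_top_iff_card_eq_finrank_add_one.2 (by simp)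
  let B : AffineBasis (Fin 3) ℝ E2 := ⟨![p₁, p₂, p₃], hind, htop⟩
  have hB : range B = {p₁, p₂, p₃} := by
    change range ![p₁, p₂, p₃] = _
    rw [Matrix.range_cons, Matrix.range_cons_cons_empty, singleton_union]
  have hr : 0 < r := hh0.trans hhr
  rw [← hB] at hΔ ho
  have ho' : ∀ i, 0 < B.coord i o := by rwa [B.interior_convexHull] at ho
  have hdist : ∀ x ∈ frontier Δ, r ≤ dist x o := by
    intro x hx
    rw [hΔ] at hx
    obtain ⟨i, hi⟩ := exists_coord_eq_zero_of_mem_frontier B hx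
    have hmem := mem_affineSpan_pair_of_coord_eq_zero B i hi
    rw [dist_comm]
    fin_cases i
    exacts [hd23 ▸ infDist_le_dist_of_mem hmem, hd31 ▸ infDist_le_dist_of_mem hmem,
      hd12 ▸ infDist_le_dist_of_mem hmem]
  have hball : ball o r ⊆ interior Δ :=
    ball_subset_interior_of_forall_mem_frontier hr (hΔ ▸ ho) hdist
  have hsphere : b '' Iio w ⊆ sphere o h := by
    rintro _ ⟨k, hk, rfl⟩
    exact (hb k hk).2
  refine ⟨?_, ?_, ?_⟩
  · refine Subset.trans (convexHull_min ?_ (convex_ball o r)) hball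
    exact hsphere.trans (sphere_subset_closedBall.trans (closedBall_subset_ball hhr))
  · exact fun k hk =>
      mem_extremePoints_convexHull_of_subset_sphere hsphere (mem_image_of_mem b hk)
  · rintro k hk ⟨s, hs, hks, hks'⟩ x hx
    have hscale : ∀ k < w, ∃ t : ℝ, 0 < t ∧ t < 1 ∧ b k - o = t • (a k - o) := by
      intro k hk
      obtain ⟨hseg, hbd⟩ := hb k hk
      rw [segment_symm, segment_eq_image'] at hseg
      obtain ⟨t, ⟨ht0, ht1⟩, ht⟩ := hseg
      have hbt : b k - o = t • (a k - o) := by rw [← ht]; simp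
      refine ⟨t, ht0.lt_of_ne ?_, ht1.lt_of_ne ?_, hbt⟩
      · rintro rfl
        rw [dist_eq_norm, hbt] at hbd
        simp at hbd
        exact hh0.ne hbd
      · rintro rfl
        rw [dist_eq_norm, hbt, one_smul, ← dist_eq_norm] at hbd
        exact absurd (hdist _ (haΔ k hk)) (by linarith)
    have hside : ∃ i, ∀ y ∈ s, B.coord i y = 0 := by
      rcases hs with rfl | rfl | rfl
      · exact ⟨2, fun y hy => coord_eq_zero_of_mem_segment B (j := 0) (k := 1)
          (by decide) (by decide) hy⟩
      · exact ⟨0, fun y hy => coord_eq_zero_of_mem_segment B (j := 1) (k := 2)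
          (by decide) (by decide) hy⟩
      · exact ⟨1, fun y hy => coord_eq_zero_of_mem_segment B (j := 2) (k := 0)
          (by decide) (by decide) hy⟩
    obtain ⟨i, hi⟩ := hside
    have hlin : ∀ y ∈ s, (B.coord i).linear (y - o) = -B.coord i o := by
      intro y hy
      have := (B.coord i).linearMap_vsub y o
      rw [hi y hy] at this
      simpa using this
    obtain ⟨j, hj, haj, hbj⟩ : ∃ j < w, a (k + 1) = a j ∧ b (k + 1) = b j := by
      rcases (Nat.succ_le_of_lt hk).eq_or_lt with hkw | hkw
      · exact ⟨0, hw, by rw [← haw, ← hkw], by rw [← hbw, ← hkw]⟩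
      · exact ⟨k + 1, hkw, rfl, rfl⟩
    rw [haj, hbj] at hx ⊢
    rw [haj] at hks'
    obtain ⟨t, ht0, ht1, ht⟩ := hscale k hk
    obtain ⟨t', ht0', ht1', ht'⟩ := hscale j hj
    rcases eq_or_ne k j with rfl | hne
    · rw [insert_eq_of_mem (mem_insert _ _), pair_eq_singleton] at hx ⊢
      refine mem_extremePoints_convexHull_pair ht1 ht (B.coord i).linear ?_ hx
      have h1 := hlin _ hks
      rw [map_sub] at h1
      linarith [ho' i]
    · refine mem_extremePoints_convexHull_of_rays ht0 ht1 ht0' ht1' ht ht' ?_ hx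
      refine exists_linearMap_apply_eq (fun e => hane k hk j hj hne (sub_left_injective e))
        (B.coord i).linear ((hlin _ hks).trans (hlin _ hks').symm) ?_
      rw [hlin _ hks]
      exact neg_ne_zero.2 (ho' i).ne'

end
end

section
/- Let p₁, p₂, p₃ ∈ ℝ² be three affinely independent points, and let A be the 2×2 real matrix whose columns are p₁ − p₃ and p₂ − p₃. Then A is invertible and the operator norm (with respect to the Euclidean norm on ℝ²) of its inverse satisfies ‖A⁻¹‖ ≤ (1 / sin ∠p₁p₃p₂) · (1/‖p₁ − p₃‖ + 1/‖p₂ − p₃‖), where ∠p₁p₃p₂ is the Euclidean angle at p₃ between p₁ and p₂. -/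
open Set Geometry EuclideanGeometry Metric Real

noncomputable section

/-- The norm of a plane vector is at most the sum of the absolute values of its coordinates. -/
lemma norm_le_abs_add_abs (v : E2) : ‖v‖ ≤ |v 0| + |v 1| := by
  rw [EuclideanSpace.norm_eq, Fin.sum_univ_two]
  refine Real.sqrt_le_iff.mpr ⟨by positivity, ?_⟩
  simp only [Real.norm_eq_abs]
  nlinarith [mul_nonneg (abs_nonneg (v 0)) (abs_nonneg (v 1))]

/-- Cauchy-Schwarz for the determinant of two plane vectors. -/
lemma abs_cross_le (a x : E2) : |a 0 * x 1 - a 1 * x 0| ≤ ‖a‖ * ‖x‖ := by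
  refine abs_le_of_sq_le_sq ?_ (by positivity)
  rw [mul_pow, EuclideanSpace.real_norm_sq_eq, EuclideanSpace.real_norm_sq_eq,
    Fin.sum_univ_two, Fin.sum_univ_two]
  nlinarith [sq_nonneg (a 0 * x 0 + a 1 * x 1)]

/-- The absolute determinant of two plane vectors is the area of the parallelogram they span. -/
lemma abs_cross_eq_sin_angle_mul (a b : E2) :
    |a 0 * b 1 - a 1 * b 0| = Real.sin (InnerProductGeometry.angle a b) * (‖a‖ * ‖b‖) := by
  rw [InnerProductGeometry.sin_angle_mul_norm_mul_norm, ← Real.sqrt_sq_eq_abs]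
  congr 1
  simp only [PiLp.inner_apply, Fin.sum_univ_two, RCLike.inner_apply, conj_trivial]
  ring

/-- bound on the Euclidean operator norm of the inverse of the
matrix with columns `p₁ - p₃` and `p₂ - p₃`. -/
theorem statement9 (p₁ p₂ p₃ : E2) (hind : AffineIndependent ℝ ![p₁, p₂, p₃])
    (A : Matrix (Fin 2) (Fin 2) ℝ)
    (hA : ∀ i : Fin 2, A i 0 = (p₁ - p₃) i ∧ A i 1 = (p₂ - p₃) i) :
    IsUnit A ∧
    ‖LinearMap.toContinuousLinearMap (Matrix.toEuclideanLin (A⁻¹))‖ ≤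
      (1 / Real.sin (∠ p₁ p₃ p₂)) * (1 / ‖p₁ - p₃‖ + 1 / ‖p₂ - p₃‖) := by
  have hsin : 0 < Real.sin (∠ p₁ p₃ p₂) := by
    refine sin_pos_of_not_collinear ?_
    rw [Set.pair_comm p₃ p₂]
    exact affineIndependent_iff_not_collinear_set.mp hind
  have ha : 0 < ‖p₁ - p₃‖ := norm_sub_pos_iff.mpr fun h => by
    simpa using hind.injective.ne (show (0 : Fin 3) ≠ 2 by decide) h
  have hb : 0 < ‖p₂ - p₃‖ := norm_sub_pos_iff.mpr fun h => by
    simpa using hind.injective.ne (show (1 : Fin 3) ≠ 2 by decide) h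
  have harea := abs_cross_eq_sin_angle_mul (p₁ - p₃) (p₂ - p₃)
  change _ = Real.sin (∠ p₁ p₃ p₂) * _ at harea
  have hdet : A.det = (p₁ - p₃) 0 * (p₂ - p₃) 1 - (p₁ - p₃) 1 * (p₂ - p₃) 0 := by
    rw [Matrix.det_fin_two, (hA 0).1, (hA 0).2, (hA 1).1, (hA 1).2]
    ring
  rw [← hdet] at harea
  have hpos : 0 < |A.det| := by rw [harea]; positivity
  refine ⟨(Matrix.isUnit_iff_isUnit_det A).mpr (isUnit_iff_ne_zero.mpr (abs_pos.mp hpos)), ?_⟩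
  refine ContinuousLinearMap.opNorm_le_bound _ (by positivity) fun x => ?_
  have hrhs : (1 / Real.sin (∠ p₁ p₃ p₂)) * (1 / ‖p₁ - p₃‖ + 1 / ‖p₂ - p₃‖) * ‖x‖ =
      |A.det|⁻¹ * (‖p₂ - p₃‖ * ‖x‖) + |A.det|⁻¹ * (‖p₁ - p₃‖ * ‖x‖) := by
    rw [harea]
    field_simp
  have h0 : (Matrix.toEuclideanLin A⁻¹ x) 0 =
      -(A.det⁻¹ * ((p₂ - p₃) 0 * x 1 - (p₂ - p₃) 1 * x 0)) := by
    rw [← (hA 0).2, ← (hA 1).2]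
    simp [Matrix.toLpLin_apply, Matrix.inv_def, Matrix.adjugate_fin_two,
      dotProduct, Fin.sum_univ_two]
    ring
  have h1 : (Matrix.toEuclideanLin A⁻¹ x) 1 =
      A.det⁻¹ * ((p₁ - p₃) 0 * x 1 - (p₁ - p₃) 1 * x 0) := by
    rw [← (hA 0).1, ← (hA 1).1]
    simp [Matrix.toLpLin_apply, Matrix.inv_def, Matrix.adjugate_fin_two,
      dotProduct, Fin.sum_univ_two]
    ring
  rw [hrhs, LinearMap.coe_toContinuousLinearMap']
  refine (norm_le_abs_add_abs _).trans ?_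
  rw [h0, h1, abs_neg, abs_mul, abs_mul, abs_inv]
  gcongr <;> exact abs_cross_le _ _

end
end

section
/- Let σ ⊂ ℝ² be a (closed, nondegenerate) triangle and let f, h : σ → ℝ² be continuous injective maps (homeomorphisms onto their images). Then f(σ) is contained in the closed neighbourhood of h(σ) of radius sup_{x ∈ ∂σ} ‖f(x) − h(x)‖; that is, every point of f(σ) lies at distance at most sup_{x ∈ ∂σ} ‖f(x) − h(x)‖ from the set h(σ). -/
open Set Geometry EuclideanGeometry Metric Real

noncomputable section

/-- `u` has a continuous logarithm. -/
def HasContinuousLog {A : Type*} [TopologicalSpace A] (u : A → ℂ) : Prop :=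
  ∃ L : A → ℂ, Continuous L ∧ ∀ a, Complex.exp (L a) = u a

namespace HasContinuousLog

variable {A : Type*} [TopologicalSpace A]

theorem const {c : ℂ} (hc : c ≠ 0) : HasContinuousLog (fun _ : A => c) :=
  ⟨fun _ => Complex.log c, continuous_const, fun _ => Complex.exp_log hc⟩

theorem of_homotopy {H : unitInterval × A → ℂ} (hH : Continuous H) (hH₀ : ∀ p, H p ≠ 0)
    (h : HasContinuousLog fun a => H (0, a)) : HasContinuousLog fun a => H (1, a) := by
  obtain ⟨L, hL, hexp⟩ := h
  have hstart : ∀ a, (⟨fun p => ⟨H p, hH₀ p⟩, hH.subtype_mk hH₀⟩ :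
      C(unitInterval × A, {z : ℂ // z ≠ 0})) (0, a) =
        ⟨Complex.exp ((⟨L, hL⟩ : C(A, ℂ)) a), Complex.exp_ne_zero _⟩ :=
    fun a => Subtype.ext (hexp a).symm
  refine ⟨fun a => Complex.isCoveringMap_exp.liftHomotopy _ _ hstart (1, a),
    (ContinuousMap.continuous _).comp (Continuous.prodMk_right 1), fun a => ?_⟩
  exact congrArg Subtype.val
    (congrFun (Complex.isCoveringMap_exp.liftHomotopy_lifts _ _ hstart) (1, a))

theorem of_norm_sub_lt {u v : A → ℂ} (hu : Continuous u) (hv : HasContinuousLog v)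
    (huv : ∀ a, ‖u a - v a‖ < ‖v a‖) : HasContinuousLog u := by
  obtain ⟨L, hL, hexp⟩ := hv
  have hvc : Continuous v := by
    rw [← funext hexp]
    exact Complex.continuous_exp.comp hL
  have hv₀ : ∀ a, v a ≠ 0 := fun a => hexp a ▸ Complex.exp_ne_zero _
  have hslit : ∀ a, u a / v a ∈ Complex.slitPlane := fun a => by
    have hnorm : ‖u a / v a - 1‖ < 1 := by
      rw [div_sub_one (hv₀ a), norm_div, div_lt_one (norm_pos_iff.2 (hv₀ a))]
      exact huv a
    simpa using Complex.mem_slitPlane_of_norm_lt_one hnorm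
  refine ⟨fun a => L a + Complex.log (u a / v a), hL.add ((hu.div hvc hv₀).clog hslit),
    fun a => ?_⟩
  rw [Complex.exp_add, hexp, Complex.exp_log (Complex.slitPlane_ne_zero (hslit a)),
    mul_div_cancel₀ _ (hv₀ a)]

/-- An odd function on a connected space with involution has no continuous logarithm. -/
theorem not_of_odd [PreconnectedSpace A] [Nonempty A] {τ : A → A} (hτ : Continuous τ)
    (hinv : Function.Involutive τ) {u : A → ℂ} (hu : ∀ a, u (τ a) = -u a) :
    ¬ HasContinuousLog u := by
  rintro ⟨L, hL, hexp⟩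
  have hdiff : ∀ a, Complex.exp (L (τ a) - L a) = -1 := fun a => by
    rw [Complex.exp_sub, hexp, hexp, hu, neg_div, div_self]
    exact hexp a ▸ Complex.exp_ne_zero _
  obtain ⟨a⟩ := ‹Nonempty A›
  have hconst : L (τ (τ a)) - L (τ a) = L (τ a) - L a :=
    Complex.isCoveringMap_exp.const_of_comp ((hL.comp hτ).sub hL)
      (fun a b => Subtype.ext ((hdiff a).trans (hdiff b).symm)) (τ a) a
  rw [hinv a] at hconst
  have hzero : L (τ a) - L a = 0 := by linear_combination -hconst / 2
  have h := hdiff a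
  rw [hzero, Complex.exp_zero] at h
  norm_num at h

end HasContinuousLog

section Ball

variable {V : Type*} [NormedAddCommGroup V] [NormedSpace ℝ V]

theorem hasContinuousLog_sphere_of_closedBall {g : V → ℂ} (hg : ContinuousOn g (closedBall 0 1))
    (hg₀ : ∀ x ∈ closedBall (0 : V) 1, g x ≠ 0) :
    HasContinuousLog fun a : sphere (0 : V) 1 => g a := by
  have hmem : ∀ p : unitInterval × sphere (0 : V) 1,
      (p.1 : ℝ) • (p.2 : V) ∈ closedBall (0 : V) 1 := fun p => by
    rw [mem_closedBall_zero_iff, norm_smul, norm_eq_of_mem_sphere, mul_one,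
      Real.norm_of_nonneg p.1.2.1]
    exact p.1.2.2
  have h := HasContinuousLog.of_homotopy
    (H := fun p : unitInterval × sphere (0 : V) 1 => g ((p.1 : ℝ) • (p.2 : V)))
    (hg.comp_continuous (by fun_prop) hmem) (fun p => hg₀ _ (hmem p))
    (by simpa using HasContinuousLog.const (hg₀ 0 (by simp)))
  simpa using h

theorem not_hasContinuousLog_sphere_of_injOn (hV : 1 < Module.rank ℝ V) {f : V → ℂ}
    (hf : ContinuousOn f (closedBall 0 1)) (hfi : InjOn f (closedBall 0 1)) :
    ¬ HasContinuousLog fun a : sphere (0 : V) 1 => f a - f 0 := by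
  intro hlog
  have : Nontrivial V := (rank_pos_iff_nontrivial (R := ℝ)).1 (zero_lt_one.trans hV)
  have : PreconnectedSpace (sphere (0 : V) 1) :=
    isPreconnected_iff_preconnectedSpace.1 (isPreconnected_sphere hV 0 1)
  have : Nonempty (sphere (0 : V) 1) := (NormedSpace.sphere_nonempty.2 zero_le_one).to_subtype
  have hpos : ∀ p : unitInterval × sphere (0 : V) 1, 0 < 1 + (p.1 : ℝ) :=
    fun p => by linarith [p.1.2.1]
  have hmem₁ : ∀ p : unitInterval × sphere (0 : V) 1,
      (1 / (1 + (p.1 : ℝ))) • (p.2 : V) ∈ closedBall (0 : V) 1 := fun p => by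
    rw [mem_closedBall_zero_iff, norm_smul, norm_eq_of_mem_sphere, mul_one,
      Real.norm_of_nonneg (by have := hpos p; positivity), div_le_one (hpos p)]
    linarith [p.1.2.1]
  have hmem₂ : ∀ p : unitInterval × sphere (0 : V) 1,
      (-((p.1 : ℝ) / (1 + (p.1 : ℝ)))) • (p.2 : V) ∈ closedBall (0 : V) 1 := fun p => by
    rw [mem_closedBall_zero_iff, norm_smul, norm_eq_of_mem_sphere, mul_one, norm_neg,
      Real.norm_of_nonneg (div_nonneg p.1.2.1 (hpos p).le), div_le_one (hpos p)]
    linarith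
  have h := HasContinuousLog.of_homotopy
    (H := fun p : unitInterval × sphere (0 : V) 1 =>
      f ((1 / (1 + (p.1 : ℝ))) • (p.2 : V)) - f ((-((p.1 : ℝ) / (1 + (p.1 : ℝ)))) • (p.2 : V)))
    ((hf.comp_continuous (by fun_prop (disch := exact fun p => (hpos p).ne')) hmem₁).sub
      (hf.comp_continuous (by fun_prop (disch := exact fun p => (hpos p).ne')) hmem₂))
    (fun p hp => by
      have heq := hfi (hmem₁ p) (hmem₂ p) (sub_eq_zero.1 hp)
      have hne : (p.2 : V) ≠ 0 := ne_zero_of_mem_unit_sphere p.2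
      have hcoef := smul_left_injective ℝ hne heq
      have := hpos p
      field_simp at hcoef
      linarith [p.1.2.1])
    (by simpa using hlog)
  refine HasContinuousLog.not_of_odd continuous_neg neg_involutive (fun a => ?_) h
  simp

/-- If `f` is injective on the unit ball of a space of dimension at least two, then `f 0` is
within `r` of the image of the ball under any map that is `r`-close to `f` on the sphere. -/
theorem exists_dist_le_of_injOn_closedBall (hV : 1 < Module.rank ℝ V) {f h : V → ℂ} {r : ℝ}
    (hf : ContinuousOn f (closedBall 0 1)) (hfi : InjOn f (closedBall 0 1))
    (hh : ContinuousOn h (closedBall 0 1)) (hr : ∀ x ∈ sphere (0 : V) 1, dist (f x) (h x) ≤ r) :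
    ∃ z ∈ closedBall (0 : V) 1, dist (f 0) (h z) ≤ r := by
  by_contra! hfar
  have hr₀ : 0 ≤ r := by
    have : Nontrivial V := (rank_pos_iff_nontrivial (R := ℝ)).1 (zero_lt_one.trans hV)
    obtain ⟨x, hx⟩ := NormedSpace.sphere_nonempty (x := (0 : V)).2 zero_le_one
    exact dist_nonneg.trans (hr x hx)
  refine not_hasContinuousLog_sphere_of_injOn hV hf hfi ?_
  refine HasContinuousLog.of_norm_sub_lt (v := fun a => h a - f 0) ?_ ?_ fun a => ?_
  · exact (hf.comp_continuous continuous_subtype_val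
      fun a => sphere_subset_closedBall a.2).sub continuous_const
  · refine hasContinuousLog_sphere_of_closedBall (g := fun x => h x - f 0)
      (hh.sub continuousOn_const) fun x hx h₀ => ?_
    have := hfar x hx
    rw [dist_comm, dist_eq_norm, h₀, norm_zero] at this
    exact this.not_ge hr₀
  · rw [sub_sub_sub_cancel_right, ← dist_eq_norm, ← dist_eq_norm, dist_comm (h a)]
    exact (hr a a.2).trans_lt (hfar a (sphere_subset_closedBall a.2))

theorem exists_homeomorph_closedBall {s : Set V} (hs : Convex ℝ s) (hsc : IsCompact s) {x : V}
    (hx : x ∈ interior s) :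
    ∃ Φ : V ≃ₜ V, Φ 0 = x ∧ MapsTo Φ (closedBall 0 1) s ∧ MapsTo Φ (sphere 0 1) (frontier s) := by
  set τ := Homeomorph.addLeft x
  have hpre : τ.symm '' s = (x + ·) ⁻¹' s := τ.symm.image_eq_preimage_symm s
  have hball := convex_closedBall (0 : V) 1
  have hball₀ : closedBall (0 : V) 1 ∈ nhds 0 := closedBall_mem_nhds 0 one_pos
  have hballb := (NormedSpace.isVonNBounded_iff ℝ).2 (isBounded_closedBall (x := (0 : V)) (r := 1))
  have ht : Convex ℝ ((x + ·) ⁻¹' s) := hs.translate_preimage_right x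
  have ht₀ : (x + ·) ⁻¹' s ∈ nhds (0 : V) :=
    (continuous_const_add x).continuousAt.preimage_mem_nhds
      (by simpa using mem_interior_iff_mem_nhds.1 hx)
  have htc : IsCompact ((x + ·) ⁻¹' s) := hpre ▸ hsc.image τ.symm.continuous
  have htb := (NormedSpace.isVonNBounded_iff ℝ).2 htc.isBounded
  set Ψ := gaugeRescaleHomeomorph _ _ hball hball₀ hballb ht ht₀ htb
  have hΨ : Ψ '' closedBall 0 1 = (x + ·) ⁻¹' s := by
    simpa only [isClosed_closedBall.closure_eq, htc.isClosed.closure_eq] using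
      image_gaugeRescaleHomeomorph_closure hball hball₀ hballb ht ht₀ htb
  have hΦ : (Ψ.trans τ) '' closedBall 0 1 = s := by
    rw [show ⇑(Ψ.trans τ) = τ ∘ Ψ from rfl, image_comp, hΨ, ← hpre, ← image_comp]
    simp
  refine ⟨Ψ.trans τ, ?_, fun y hy => hΦ ▸ mem_image_of_mem _ hy, fun y hy => ?_⟩
  · simp [Ψ, τ, gaugeRescaleHomeomorph, gaugeRescaleEquiv]
  · rw [← hΦ, ← Homeomorph.image_frontier]
    exact mem_image_of_mem _ (by rwa [frontier_closedBall _ one_ne_zero])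

end Ball

/-- the image of a triangle under `f` lies in the closed
neighbourhood of its image under `h` of radius `sup_{∂σ} ‖f - h‖`. -/
theorem statement11 (p₁ p₂ p₃ : E2) (hind : AffineIndependent ℝ ![p₁, p₂, p₃])
    (σ : Set E2) (hσ : σ = convexHull ℝ {p₁, p₂, p₃})
    (f h : E2 → E2)
    (hf : ContinuousOn f σ) (hfi : Set.InjOn f σ)
    (hh : ContinuousOn h σ) (hhi : Set.InjOn h σ) :
    ∀ y ∈ f '' σ,
      Metric.infDist y (h '' σ) ≤ sSup ((fun x => ‖f x - h x‖) '' frontier σ) := by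
  rintro _ ⟨x, hx, rfl⟩
  have hconv : Convex ℝ σ := hσ ▸ convex_convexHull ℝ _
  have hcomp : IsCompact σ := hσ ▸ (toFinite {p₁, p₂, p₃}).isCompact_convexHull ℝ
  have hsub : frontier σ ⊆ σ := hcomp.isClosed.frontier_subset
  have hbdd : BddAbove ((fun x => ‖f x - h x‖) '' frontier σ) :=
    ((hcomp.of_isClosed_subset isClosed_frontier hsub).image_of_continuousOn
      ((hf.sub hh).norm.mono hsub)).bddAbove
  have hle : ∀ z ∈ frontier σ, dist (f z) (h z) ≤ sSup ((fun x => ‖f x - h x‖) '' frontier σ) :=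
    fun z hz => dist_eq_norm (f z) (h z) ▸ le_csSup hbdd (mem_image_of_mem _ hz)
  suffices ∃ z ∈ σ, dist (f x) (h z) ≤ sSup ((fun x => ‖f x - h x‖) '' frontier σ) by
    obtain ⟨z, hz, hdist⟩ := this
    exact (infDist_le_dist_of_mem (mem_image_of_mem h hz)).trans hdist
  by_cases hint : x ∈ interior σ
  · obtain ⟨Φ, hΦ₀, hΦ, hΦ_frontier⟩ := exists_homeomorph_closedBall hconv hcomp hint
    let e : E2 ≃ₗᵢ[ℝ] ℂ := Complex.orthonormalBasisOneI.repr.symm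
    have hrank : 1 < Module.rank ℝ E2 := by
      rw [← Module.finrank_eq_rank, finrank_euclideanSpace_fin]
      norm_num
    obtain ⟨z, hz, hdist⟩ := exists_dist_le_of_injOn_closedBall hrank
      (f := e ∘ f ∘ Φ) (h := e ∘ h ∘ Φ)
      (e.continuous.comp_continuousOn (hf.comp Φ.continuous.continuousOn hΦ))
      (e.injective.comp_injOn (hfi.comp Φ.injective.injOn hΦ))
      (e.continuous.comp_continuousOn (hh.comp Φ.continuous.continuousOn hΦ))
      (fun y hy => (e.dist_map _ _).trans_le (hle _ (hΦ_frontier hy)))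
    refine ⟨Φ z, hΦ hz, ?_⟩
    simpa only [Function.comp_apply, hΦ₀, e.dist_map] using hdist
  · exact ⟨x, hx, hle x ⟨subset_closure hx, hint⟩⟩

end
end

section
/- Let σ₁, σ₂ ⊂ ℝ² be two (closed, nondegenerate) triangles such that σ₁ ∩ σ₂ is either empty, or equal to a segment that is a side of both σ₁ and σ₂, or equal to a single point that is a vertex of both σ₁ and σ₂. Let f : σ₁ ∪ σ₂ → ℝ² be a function such that the restrictions f|σ₁ and f|σ₂ are continuous and injective, and f is injective on ∂σ₁ ∪ ∂σ₂. Suppose that for every vertex w₁ of σ₁ with w₁ ∉ σ₂ one has f(w₁) ∉ f(σ₂), and for every vertex w₂ of σ₂ with w₂ ∉ σ₁ one has f(w₂) ∉ f(σ₁). Then f(int σ₁) ∩ f(σ₂) = ∅, where int σ₁ is the topological interior of σ₁ in ℝ². -/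
open Set Geometry EuclideanGeometry Metric Real

noncomputable section

/-- A continuous map of the closed unit disc into the plane that is at distance less than `1` from
the identity on the unit circle has a zero. -/
theorem exists_zero_of_near_id_on_sphere {h : ℂ → ℂ}
    (hc : ContinuousOn h (closedBall 0 1)) (hh : ∀ z ∈ sphere (0 : ℂ) 1, ‖h z - z‖ < 1) :
    ∃ z ∈ closedBall (0 : ℂ) 1, h z = 0 := by
  by_contra! hne
  set r : ℂ → ℂ := fun z => ((max 1 ‖z‖)⁻¹ : ℝ) * z with hr
  have hpos : ∀ z : ℂ, 0 < max 1 ‖z‖ := fun z => lt_max_of_lt_left one_pos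
  have hrc : Continuous r := by
    have : Continuous fun z : ℂ => (max 1 ‖z‖)⁻¹ :=
      (continuous_const.max continuous_norm).inv₀ fun z => (hpos z).ne'
    exact (Complex.continuous_ofReal.comp this).mul continuous_id
  have hrm : ∀ z, r z ∈ closedBall (0 : ℂ) 1 := fun z => by
    rw [mem_closedBall_zero_iff, hr, norm_mul, Complex.norm_real, norm_inv,
      Real.norm_of_nonneg (hpos z).le, inv_mul_le_one₀ (hpos z)]
    exact le_max_right _ _
  have hrs : ∀ z : ℂ, ‖z‖ = 1 → r z = z := fun z hz => by simp [hr, hz]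
  obtain ⟨F, ⟨-, hF⟩, -⟩ := Complex.isCoveringMapOn_exp.existsUnique_continuousMap_lifts
    ⟨fun z => h (r z), hc.comp_continuous hrc hrm⟩
    (a₀ := 0) (Complex.exp_log (hne _ (hrm 0))) (fun z => hne _ (hrm z))
  have hFz : ∀ z : ℂ, ‖z‖ = 1 → Complex.exp (F z) = h z := fun z hz => by
    simpa [hrs z hz] using congrFun hF z
  set e : ℝ → ℂ := fun θ => Complex.exp (θ * Complex.I) with he
  have hec : Continuous e := by fun_prop
  have hen : ∀ θ, ‖e θ‖ = 1 := fun θ => Complex.norm_exp_ofReal_mul_I θ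
  have hes : ∀ θ, e θ ∈ sphere (0 : ℂ) 1 := fun θ => by simp [hen θ]
  have hslit : ∀ θ, h (e θ) / e θ ∈ Complex.slitPlane := fun θ => by
    have h0 : e θ ≠ 0 := Complex.exp_ne_zero _
    have := Complex.mem_slitPlane_of_norm_lt_one (z := (h (e θ) - e θ) / e θ)
      (by rw [norm_div, hen, div_one]; exact hh _ (hes θ))
    rwa [sub_div, div_self h0, add_sub_cancel] at this
  have hhe : Continuous fun θ => h (e θ) :=
    hc.comp_continuous hec fun θ => sphere_subset_closedBall (hes θ)
  set φ : ℝ → ℂ := fun θ => F (e θ) - Complex.log (h (e θ) / e θ) - θ * Complex.I with hφ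
  have hφc : Continuous φ := by
    refine ((F.continuous.comp hec).sub (Continuous.clog ?_ hslit)).sub (by fun_prop)
    exact hhe.div hec fun θ => Complex.exp_ne_zero _
  have hφ1 : ∀ θ, ∃ n : ℤ, (φ θ).im = n * (2 * π) := fun θ => by
    have h0 : e θ ≠ 0 := Complex.exp_ne_zero _
    have h1 : h (e θ) ≠ 0 := hne _ (sphere_subset_closedBall (hes θ))
    have : Complex.exp (φ θ) = 1 := by
      rw [hφ]
      simp only [Complex.exp_sub]
      rw [Complex.exp_log (div_ne_zero h1 h0), hFz _ (hen θ)]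
      change h (e θ) / (h (e θ) / e θ) / e θ = 1
      field_simp
    obtain ⟨n, hn⟩ := Complex.exp_eq_one_iff.1 this
    exact ⟨n, by simp [hn]⟩
  have hper : e (2 * π) = e 0 := by simp [he]
  have hdiff : (φ 0).im = (φ (2 * π)).im + 2 * π := by
    simp [hφ, hper]
  obtain ⟨θ, hθ⟩ := mem_range_of_exists_le_of_exists_ge (c := (φ (2 * π)).im + π)
    (Complex.continuous_im.comp hφc)
    ⟨2 * π, by simp [pi_pos.le]⟩ ⟨0, by simp [hdiff]; linarith [pi_pos]⟩
  obtain ⟨n, hn⟩ := hφ1 θ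
  obtain ⟨m, hm⟩ := hφ1 (2 * π)
  simp only [Function.comp_apply] at hθ
  rw [hn, hm] at hθ
  have : (2 * n : ℝ) = 2 * m + 1 := by
    apply mul_right_cancel₀ pi_ne_zero
    linarith
  have : 2 * n = 2 * m + 1 := by exact_mod_cast this
  lia

/-- A continuous injective map of the closed unit disc into the plane sends the centre to an
interior point of the image. -/
theorem mem_interior_image_closedBall {f : ℂ → ℂ} (hc : ContinuousOn f (closedBall 0 1))
    (hi : InjOn f (closedBall 0 1)) : f 0 ∈ interior (f '' closedBall 0 1) := by
  by_contra hint
  have h0 : (0 : ℂ) ∈ closedBall (0 : ℂ) 1 := by simp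
  have hK : IsCompact (f '' closedBall 0 1) := (isCompact_closedBall _ _).image_of_continuousOn hc
  obtain ⟨G, hG⟩ : ∃ G : C(ℂ, ℂ), ∀ z ∈ closedBall (0 : ℂ) 1, G (f z) = z := by
    have hemb : Topology.IsClosedEmbedding ((closedBall (0 : ℂ) 1).domRestrict f) :=
      (continuousOn_iff_continuous_domRestrict.1 hc).isClosedEmbedding
        (injOn_iff_injective.1 hi)
    obtain ⟨G, hG⟩ := ContinuousMap.exists_extension' (Y := ℂ) hemb
      ⟨Subtype.val, continuous_subtype_val⟩
    exact ⟨G, fun z hz => congrFun hG ⟨z, hz⟩⟩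
  have hG0 : G (f 0) = 0 := hG 0 h0
  obtain ⟨η, hη, hGη⟩ := Metric.continuous_iff.1 G.continuous (f 0) (1 / 10) (by norm_num)
  set ε := η / 3 with hε
  have hεpos : 0 < ε := by positivity
  have hGε : ∀ y, dist y (f 0) ≤ 2 * ε → ‖G y‖ < 1 / 10 := fun y hy => by
    have := hGη y (by linarith)
    rwa [hG0, dist_zero_right] at this
  obtain ⟨c, hcε, hcK⟩ : ∃ c, dist c (f 0) < ε ∧ c ∉ f '' closedBall 0 1 := by
    by_contra! hall
    exact hint (mem_interior_iff_mem_nhds.2 (Filter.mem_of_superset (ball_mem_nhds _ hεpos) hall))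
  have hS : IsCompact (f '' closedBall 0 1 ∩ (ball c ε)ᶜ) :=
    hK.inter_right isOpen_ball.isClosed_compl
  obtain ⟨δ₀, hδ₀, hGδ₀⟩ := hS.exists_forall_le' (f := fun y => ‖G y‖) (a := 0)
    G.continuous.norm.continuousOn (by
      rintro _ ⟨⟨z, hz, rfl⟩, hzc⟩
      rw [norm_pos_iff, hG z hz]
      rintro rfl
      exact hzc (by rwa [mem_ball, dist_comm]))
  set δ := min δ₀ (1 / 10) with hδ
  have hδpos : 0 < δ := lt_min hδ₀ (by norm_num)
  obtain ⟨Q, hQ, hQG, -⟩ := G.continuous.exists_contDiff_approx 1 (ε := fun _ => δ / 2)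
    continuous_const (fun _ => by positivity)
  obtain ⟨v, hv, hvδ⟩ : ∃ v, v ∉ Q '' sphere c ε ∧ ‖v‖ < δ / 2 := by
    have hnull : MeasureTheory.volume (Q '' sphere c ε) = 0 :=
      MeasureTheory.addHaar_image_eq_zero_of_differentiableOn_of_addHaar_eq_zero _
        (hQ.differentiable (by norm_num)).differentiableOn
        (MeasureTheory.Measure.addHaar_sphere _ _ _)
    by_contra! hall
    have hsub : ball (0 : ℂ) (δ / 2) ⊆ Q '' sphere c ε := fun v hv => by
      by_contra hv'
      exact absurd (mem_ball_zero_iff.1 hv) (not_lt.2 (hall v hv'))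
    exact (Metric.measure_ball_pos MeasureTheory.volume (0 : ℂ) (half_pos hδpos)).ne'
      (MeasureTheory.measure_mono_null hsub hnull)
  have hPG : ∀ y, ‖Q y - v - G y‖ < δ := fun y => by
    have h1 := hQG y
    rw [dist_eq_norm] at h1
    calc ‖Q y - v - G y‖ = ‖(Q y - G y) - v‖ := by congr 1; ring
      _ ≤ ‖Q y - G y‖ + ‖v‖ := norm_sub_le _ _
      _ < δ := by linarith
  set Φ : ℂ → ℂ := fun y => c + (max (ε / ‖y - c‖) 1 : ℝ) * (y - c) with hΦ
  have hΦfar : ∀ y, ε ≤ ‖y - c‖ → Φ y = y := fun y hy => by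
    have : ε / ‖y - c‖ ≤ 1 := (div_le_one (hεpos.trans_le hy)).2 hy
    simp [hΦ, max_eq_right this]
  have hΦnear : ∀ y, y ≠ c → ‖y - c‖ < ε → Φ y ∈ sphere c ε := fun y hyc hy => by
    have hpos : 0 < ‖y - c‖ := norm_pos_iff.2 (sub_ne_zero.2 hyc)
    have : 1 ≤ ε / ‖y - c‖ := (one_le_div hpos).2 hy.le
    rw [Metric.mem_sphere, dist_eq_norm, hΦ]
    simp only [max_eq_left this, add_sub_cancel_left, norm_mul, Complex.norm_real]
    rw [Real.norm_of_nonneg (by positivity)]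
    field_simp
  have hne : ∀ z ∈ closedBall (0 : ℂ) 1, f z ≠ c := fun z hz hzc => hcK ⟨z, hz, hzc⟩
  obtain ⟨z, hz, hz0⟩ := exists_zero_of_near_id_on_sphere (h := fun z => Q (Φ (f z)) - v) (by
      refine (hQ.continuous.comp_continuousOn ?_).sub continuousOn_const
      refine continuousOn_const.add (ContinuousOn.mul ?_ (hc.sub continuousOn_const))
      refine Complex.continuous_ofReal.comp_continuousOn ?_
      refine ContinuousOn.sup (continuousOn_const.div (hc.sub continuousOn_const).norm ?_)
        continuousOn_const
      exact fun z hz => norm_ne_zero_iff.2 (sub_ne_zero.2 (hne z hz))) (by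
      intro z hz'
      have hz := sphere_subset_closedBall hz'
      have hδ' : δ ≤ 1 / 10 := min_le_right _ _
      have hGz := hG z hz
      rcases le_or_gt ε ‖f z - c‖ with hfar | hnear
      · have := hPG (f z)
        rw [hGz] at this
        simp only [hΦfar _ hfar]
        linarith
      · have h1 := Metric.mem_sphere.1 (hΦnear _ (hne z hz) hnear)
        have h2 := hGε (Φ (f z)) (by linarith [dist_triangle (Φ (f z)) c (f 0)])
        have h3 := hGε (f z) (by
          rw [← dist_eq_norm] at hnear
          linarith [dist_triangle (f z) c (f 0)])
        rw [hGz] at h3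
        have h4 := hPG (Φ (f z))
        calc ‖Q (Φ (f z)) - v - z‖
            = ‖(Q (Φ (f z)) - v - G (Φ (f z))) + G (Φ (f z)) - z‖ := by congr 1; ring
          _ ≤ ‖(Q (Φ (f z)) - v - G (Φ (f z))) + G (Φ (f z))‖ + ‖z‖ := norm_sub_le _ _
          _ ≤ ‖Q (Φ (f z)) - v - G (Φ (f z))‖ + ‖G (Φ (f z))‖ + ‖z‖ := by
            gcongr; exact norm_add_le _ _
          _ < 1 := by linarith)
  rcases le_or_gt ε ‖f z - c‖ with hfar | hnear
  · simp only [hΦfar _ hfar] at hz0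
    have h1 := hPG (f z)
    rw [hz0, zero_sub, norm_neg] at h1
    have h2 := hGδ₀ (f z) ⟨⟨z, hz, rfl⟩, by simpa [dist_eq_norm] using hfar⟩
    exact absurd (h2.trans_lt h1) (not_lt.2 (min_le_left _ _))
  · exact hv ⟨_, hΦnear _ (hne z hz) hnear, sub_eq_zero.1 hz0⟩

/-- **Invariance of domain** in the complex plane. -/
theorem Complex.isOpen_image_of_injOn {f : ℂ → ℂ} {U : Set ℂ} (hU : IsOpen U)
    (hc : ContinuousOn f U) (hi : InjOn f U) : IsOpen (f '' U) := by
  rw [isOpen_iff_mem_nhds]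
  rintro _ ⟨x, hx, rfl⟩
  obtain ⟨r, hr, hrU⟩ := Metric.nhds_basis_closedBall.mem_iff.1 (hU.mem_nhds hx)
  set g : ℂ → ℂ := fun z => x + r * z with hg
  have hgm : MapsTo g (closedBall 0 1) U := fun z hz => hrU (by
    rw [mem_closedBall_zero_iff] at hz
    simp only [hg, mem_closedBall, dist_eq_norm, add_sub_cancel_left, norm_mul, Complex.norm_real,
      Real.norm_of_nonneg hr.le]
    nlinarith)
  have hgi : Function.Injective g := fun a b hab => by
    simpa [hg, hr.ne'] using hab
  have hgc : Continuous g := by fun_prop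
  have := mem_interior_image_closedBall (hc.comp hgc.continuousOn hgm)
    (hi.comp hgi.injOn hgm)
  refine Filter.mem_of_superset (mem_interior_iff_mem_nhds.1 (by simpa [hg] using this)) ?_
  rintro _ ⟨z, hz, rfl⟩
  exact mem_image_of_mem f (hgm hz)

/-- **Invariance of domain** in the Euclidean plane. -/
theorem EuclideanSpace.isOpen_image_of_injOn_two
    {f : EuclideanSpace ℝ (Fin 2) → EuclideanSpace ℝ (Fin 2)} {U : Set (EuclideanSpace ℝ (Fin 2))}
    (hU : IsOpen U) (hc : ContinuousOn f U) (hi : InjOn f U) : IsOpen (f '' U) := by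
  let e : ℂ ≃ₜ EuclideanSpace ℝ (Fin 2) :=
    Complex.orthonormalBasisOneI.repr.toHomeomorph
  have := Complex.isOpen_image_of_injOn (f := e.symm ∘ f ∘ e) (hU.preimage e.continuous)
    (e.symm.continuous.comp_continuousOn (hc.comp e.continuous.continuousOn (mapsTo_preimage _ _)))
    (e.symm.injective.comp_injOn (hi.comp e.injective.injOn (mapsTo_preimage _ _)))
  rwa [image_comp, image_comp, image_preimage_eq _ e.surjective, e.symm.isOpen_image] at this

theorem isCompact_triangle (p q r : E2) : IsCompact (convexHull ℝ {p, q, r}) :=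
  (toFinite _).isCompact_convexHull ℝ

theorem Matrix.range_vec_three {α : Type*} (a b c : α) : range ![a, b, c] = {a, b, c} := by
  simp only [Matrix.range_cons, Matrix.range_empty, union_empty]
  rfl

theorem affineSpan_triangle_eq_top {p q r : E2} (h : AffineIndependent ℝ ![p, q, r]) :
    affineSpan ℝ (range ![p, q, r]) = ⊤ :=
  h.affineSpan_eq_top_iff_card_eq_finrank_add_one.2 (by simp)

theorem interior_triangle_nonempty {p q r : E2} (h : AffineIndependent ℝ ![p, q, r]) :
    (interior (convexHull ℝ {p, q, r})).Nonempty := by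
  have := affineSpan_triangle_eq_top h
  rw [← interior_convexHull_nonempty_iff_affineSpan_eq_top] at this
  rwa [Matrix.range_vec_three] at this

/-- The boundary of a triangle is the union of its sides. -/
theorem frontier_triangle {p q r : E2} (h : AffineIndependent ℝ ![p, q, r]) :
    frontier (convexHull ℝ {p, q, r}) = segment ℝ p q ∪ segment ℝ q r ∪ segment ℝ r p := by
  let b : AffineBasis (Fin 3) ℝ E2 := ⟨![p, q, r], h, affineSpan_triangle_eq_top h⟩
  have hb0 : b 0 = p := rfl
  have hb1 : b 1 = q := rfl
  have hb2 : b 2 = r := rfl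
  have hrange : range b = {p, q, r} := Matrix.range_vec_three p q r
  have hmem : ∀ x, x ∈ frontier (convexHull ℝ {p, q, r}) ↔
      (∀ i, 0 ≤ b.coord i x) ∧ ∃ i, b.coord i x ≤ 0 := fun x => by
    rw [(isCompact_triangle p q r).isClosed.frontier_eq, ← hrange, mem_sdiff,
      b.interior_convexHull, b.convexHull_eq_nonneg_coord]
    simp
  have hside : ∀ i j k, k ≠ i → k ≠ j → ∀ x ∈ segment ℝ (b i) (b j),
      x ∈ frontier (convexHull ℝ {p, q, r}) := fun i j k hki hkj x hx => by
    refine (hmem x).2 ⟨?_, k, ?_⟩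
    · have : x ∈ convexHull ℝ (range b) :=
        segment_subset_convexHull (mem_range_self i) (mem_range_self j) hx
      rwa [b.convexHull_eq_nonneg_coord] at this
    · rw [segment_eq_image_lineMap] at hx
      obtain ⟨t, -, rfl⟩ := hx
      rw [AffineMap.apply_lineMap, b.coord_apply_ne hki, b.coord_apply_ne hkj]
      simp
  ext x
  refine ⟨fun hx => ?_, ?_⟩
  · obtain ⟨hnn, i, hi⟩ := (hmem x).1 hx
    have hi0 := le_antisymm hi (hnn i)
    have hsum := b.sum_coord_apply_eq_one x
    have hx := b.linear_combination_coord_eq_self x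
    rw [Fin.sum_univ_three] at hsum hx
    rw [hb0, hb1, hb2] at hx
    fin_cases i
    · replace hi0 : b.coord 0 x = 0 := hi0
      refine Or.inl (Or.inr ⟨_, _, hnn 1, hnn 2, ?_, ?_⟩)
      · simpa [hi0] using hsum
      · simpa [hi0] using hx
    · replace hi0 : b.coord 1 x = 0 := hi0
      refine Or.inr ⟨_, _, hnn 2, hnn 0, ?_, ?_⟩
      · simpa [hi0, add_comm] using hsum
      · simpa [hi0, add_comm] using hx
    · replace hi0 : b.coord 2 x = 0 := hi0
      refine Or.inl (Or.inl ⟨_, _, hnn 0, hnn 1, ?_, ?_⟩)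
      · simpa [hi0] using hsum
      · simpa [hi0] using hx
  · rintro ((hx | hx) | hx)
    · exact hside 0 1 2 (by decide) (by decide) x hx
    · exact hside 1 2 0 (by decide) (by decide) x hx
    · exact hside 2 0 1 (by decide) (by decide) x hx

theorem Convex.exists_endpoint_disjoint_segment {E : Type*} [AddCommGroup E] [Module ℝ E]
    {s : Set E} (hs : Convex ℝ s) {a b x : E} (hx : x ∈ segment ℝ a b) (hxs : x ∉ s) :
    Disjoint (segment ℝ a x) s ∨ Disjoint (segment ℝ b x) s := by
  by_contra! h
  simp only [not_disjoint_iff] at h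
  obtain ⟨⟨y, hy, hys⟩, z, hz, hzs⟩ := h
  refine hxs (hs.segment_subset hys hzs ?_)
  rw [mem_segment_iff_wbtw] at *
  rw [wbtw_comm] at hz
  exact (hx.trans_left_right hy).trans_right_left hz

theorem closure_image_interior_eq {X Y : Type*} [TopologicalSpace X] [TopologicalSpace Y] [T2Space Y]
    {f : X → Y} {s : Set X} (hs : IsCompact s) (hcl : closure (interior s) = s)
    (hc : ContinuousOn f s) : closure (f '' interior s) = f '' s := by
  refine subset_antisymm ?_ ?_
  · exact closure_minimal (image_mono interior_subset) (hs.image_of_continuousOn hc).isClosed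
  · conv_lhs => rw [← hcl]
    exact ContinuousOn.image_closure (hcl.symm ▸ hc)

theorem frontier_image_interior {f : E2 → E2} {s : Set E2} (hs : IsCompact s)
    (hcl : closure (interior s) = s) (hc : ContinuousOn f s) (hi : InjOn f s) :
    frontier (f '' interior s) = f '' frontier s := by
  rw [(EuclideanSpace.isOpen_image_of_injOn_two isOpen_interior (hc.mono interior_subset)
    (hi.mono interior_subset)).frontier_eq, closure_image_interior_eq hs hcl hc,
    hs.isClosed.frontier_eq, hi.image_sdiff_subset interior_subset]

theorem IsPreconnected.subset_of_disjoint_frontier {X : Type*} [TopologicalSpace X] {s t : Set X}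
    (hs : IsPreconnected s) (hst : (s ∩ t).Nonempty) (hd : Disjoint s (frontier t)) : s ⊆ t := by
  have hcov : ∀ x ∈ s, x ∈ closure t → x ∈ interior t := fun x hx hxt => by
    by_contra hxi
    exact hd.notMem_of_mem_left hx ⟨hxt, hxi⟩
  obtain ⟨x, hx, hxt⟩ := hst
  refine (hs.subset_left_of_subset_union isOpen_interior isClosed_closure.isOpen_compl
    (disjoint_compl_right_iff_subset.2 (interior_subset.trans subset_closure)) (fun y hy => ?_)
    ⟨x, hx, hcov x hx (subset_closure hxt)⟩).trans interior_subset
  by_cases hyt : y ∈ closure t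
  exacts [Or.inl (hcov y hy hyt), Or.inr hyt]

/-- A boundary point of the triangle `pqr` does not map into the image of the interior of a convex
body whose image misses the images of the vertices of the triangle outside that body. -/
theorem apply_notMem_image_interior {p q r : E2} (h : AffineIndependent ℝ ![p, q, r])
    {s : Set E2} (hs : IsCompact s) (hconv : Convex ℝ s) (hcl : closure (interior s) = s)
    {f : E2 → E2} (hc : ContinuousOn f s) (hi : InjOn f s)
    (hct : ContinuousOn f (convexHull ℝ {p, q, r}))
    (hib : InjOn f (frontier s ∪ frontier (convexHull ℝ {p, q, r})))
    (hv : ∀ w ∈ ({p, q, r} : Set E2), w ∉ s → f w ∉ f '' s)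
    {x : E2} (hx : x ∈ frontier (convexHull ℝ {p, q, r})) (hxs : x ∉ interior s) :
    f x ∉ f '' interior s := by
  have hfr : frontier s ⊆ s := hs.isClosed.frontier_subset
  have htr : frontier (convexHull ℝ {p, q, r}) ⊆ convexHull ℝ {p, q, r} :=
    (isCompact_triangle p q r).isClosed.frontier_subset
  by_cases hx' : x ∈ s
  · rintro ⟨y, hy, hyx⟩
    exact hxs (hi (interior_subset hy) hx' hyx ▸ hy)
  obtain ⟨v, hvmem, hseg, hdis⟩ : ∃ v ∈ ({p, q, r} : Set E2),
      segment ℝ v x ⊆ frontier (convexHull ℝ {p, q, r}) ∧ Disjoint (segment ℝ v x) s := by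
    have key : ∀ a b, a ∈ ({p, q, r} : Set E2) → b ∈ ({p, q, r} : Set E2) →
        segment ℝ a b ⊆ frontier (convexHull ℝ {p, q, r}) → x ∈ segment ℝ a b →
        ∃ v ∈ ({p, q, r} : Set E2),
          segment ℝ v x ⊆ frontier (convexHull ℝ {p, q, r}) ∧ Disjoint (segment ℝ v x) s := by
      intro a b ha hb hab hxab
      have hsub := fun v hv => ((convex_segment a b).segment_subset (x := v) hv hxab).trans hab
      rcases hconv.exists_endpoint_disjoint_segment hxab hx' with hd | hd
      · exact ⟨a, ha, hsub a (left_mem_segment ℝ a b), hd⟩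
      · exact ⟨b, hb, hsub b (right_mem_segment ℝ a b), hd⟩
    have hF := frontier_triangle h
    rw [hF] at hx
    rcases hx with (hx | hx) | hx
    · exact key p q (by simp) (by simp) (hF ▸ fun y hy => Or.inl (Or.inl hy)) hx
    · exact key q r (by simp) (by simp) (hF ▸ fun y hy => Or.inl (Or.inr hy)) hx
    · exact key r p (by simp) (by simp) (hF ▸ fun y hy => Or.inr hy) hx
  have hvs := hv v hvmem (hdis.notMem_of_mem_left (left_mem_segment ℝ v x))
  intro hfx
  have hpre : IsPreconnected (f '' segment ℝ v x) :=
    (convex_segment v x).isPreconnected.image f (hct.mono (hseg.trans htr))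
  have hsub : f '' segment ℝ v x ⊆ f '' interior s := by
    refine hpre.subset_of_disjoint_frontier
      ⟨f x, mem_image_of_mem f (right_mem_segment ℝ v x), hfx⟩ ?_
    rw [frontier_image_interior hs hcl hc hi]
    exact Set.disjoint_image_image fun a ha b hb hab => hdis.ne_of_mem ha (hfr hb)
      (hib (Or.inr (hseg ha)) (Or.inl hb) hab)
  exact hvs (image_mono interior_subset (hsub (mem_image_of_mem f (left_mem_segment ℝ v x))))

/-- injectivity across two adjacent triangles: the image of the
interior of one triangle does not meet the image of the other. -/
theorem statement12 (p₁ q₁ r₁ p₂ q₂ r₂ : E2)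
    (h1 : AffineIndependent ℝ ![p₁, q₁, r₁]) (h2 : AffineIndependent ℝ ![p₂, q₂, r₂])
    (σ₁ σ₂ : Set E2)
    (hσ₁ : σ₁ = convexHull ℝ {p₁, q₁, r₁}) (hσ₂ : σ₂ = convexHull ℝ {p₂, q₂, r₂})
    (hinter : σ₁ ∩ σ₂ = ∅ ∨
      (∃ s, s ∈ ({segment ℝ p₁ q₁, segment ℝ q₁ r₁, segment ℝ r₁ p₁} : Set (Set E2)) ∧
            s ∈ ({segment ℝ p₂ q₂, segment ℝ q₂ r₂, segment ℝ r₂ p₂} : Set (Set E2)) ∧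
            σ₁ ∩ σ₂ = s) ∨
      (∃ v, v ∈ ({p₁, q₁, r₁} : Set E2) ∧ v ∈ ({p₂, q₂, r₂} : Set E2) ∧
            σ₁ ∩ σ₂ = {v}))
    (f : E2 → E2)
    (hc1 : ContinuousOn f σ₁) (hi1 : Set.InjOn f σ₁)
    (hc2 : ContinuousOn f σ₂) (hi2 : Set.InjOn f σ₂)
    (hib : Set.InjOn f (frontier σ₁ ∪ frontier σ₂))
    (hv1 : ∀ w ∈ ({p₁, q₁, r₁} : Set E2), w ∉ σ₂ → f w ∉ f '' σ₂)
    (hv2 : ∀ w ∈ ({p₂, q₂, r₂} : Set E2), w ∉ σ₁ → f w ∉ f '' σ₁) :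
    f '' interior σ₁ ∩ f '' σ₂ = ∅ := by
  have side : ∀ {p q r : E2}, AffineIndependent ℝ ![p, q, r] →
      ∀ s ∈ ({segment ℝ p q, segment ℝ q r, segment ℝ r p} : Set (Set E2)),
        s ⊆ frontier (convexHull ℝ {p, q, r}) := by
    intro p q r h s hs x hx
    rw [frontier_triangle h]
    rcases hs with rfl | rfl | rfl
    exacts [Or.inl (Or.inl hx), Or.inl (Or.inr hx), Or.inr hx]
  have vertex : ∀ {p q r : E2}, AffineIndependent ℝ ![p, q, r] →
      ({p, q, r} : Set E2) ⊆ frontier (convexHull ℝ {p, q, r}) := by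
    intro p q r h x hx
    rw [frontier_triangle h]
    rcases hx with rfl | rfl | rfl
    exacts [Or.inl (Or.inl (left_mem_segment ℝ _ _)), Or.inl (Or.inr (left_mem_segment ℝ _ _)),
      Or.inr (left_mem_segment ℝ _ _)]
  have hI : σ₁ ∩ σ₂ ⊆ frontier σ₁ ∩ frontier σ₂ := by
    rcases hinter with h | ⟨s, hs1, hs2, h⟩ | ⟨v, hv1, hv2, h⟩
    · simp [h]
    · rw [h, hσ₁, hσ₂]
      exact subset_inter (side h1 s hs1) (side h2 s hs2)
    · rw [h, hσ₁, hσ₂, singleton_subset_iff]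
      exact ⟨vertex h1 hv1, vertex h2 hv2⟩
  have hco1 : IsCompact σ₁ := hσ₁ ▸ isCompact_triangle p₁ q₁ r₁
  have hco2 : IsCompact σ₂ := hσ₂ ▸ isCompact_triangle p₂ q₂ r₂
  have hcv1 : Convex ℝ σ₁ := hσ₁ ▸ convex_convexHull ℝ _
  have hcv2 : Convex ℝ σ₂ := hσ₂ ▸ convex_convexHull ℝ _
  have hne1 : (interior σ₁).Nonempty := hσ₁ ▸ interior_triangle_nonempty h1
  have hne2 : (interior σ₂).Nonempty := hσ₂ ▸ interior_triangle_nonempty h2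
  have hcl1 : closure (interior σ₁) = σ₁ := by
    rw [hcv1.closure_interior_eq_closure_of_nonempty_interior hne1, hco1.isClosed.closure_eq]
  have hcl2 : closure (interior σ₂) = σ₂ := by
    rw [hcv2.closure_interior_eq_closure_of_nonempty_interior hne2, hco2.isClosed.closure_eq]
  have hd1 : ∀ x ∈ σ₂, x ∉ interior σ₁ := fun x hx hx1 =>
    (hI ⟨interior_subset hx1, hx⟩).1.2 hx1
  have hd2 : ∀ x ∈ σ₁, x ∉ interior σ₂ := fun x hx hx2 =>
    (hI ⟨hx, interior_subset hx2⟩).2.2 hx2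
  have hf1 := frontier_image_interior hco1 hcl1 hc1 hi1
  have hf2 := frontier_image_interior hco2 hcl2 hc2 hi2
  have hB2 : ∀ x ∈ frontier σ₂, f x ∉ f '' interior σ₁ := fun x hx => by
    refine apply_notMem_image_interior h2 hco1 hcv1 hcl1 hc1 hi1 ?_ ?_ hv2 ?_
      (hd1 x (hco2.isClosed.frontier_subset hx)) <;> rwa [← hσ₂]
  have hB1 : ∀ x ∈ frontier σ₁, f x ∉ f '' interior σ₂ := fun x hx => by
    rw [union_comm] at hib
    refine apply_notMem_image_interior h1 hco2 hcv2 hcl2 hc2 hi2 ?_ ?_ hv1 ?_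
      (hd2 x (hco1.isClosed.frontier_subset hx)) <;> rwa [← hσ₁]
  rw [← not_nonempty_iff_eq_empty]
  rintro ⟨_, hx1, x, hx, rfl⟩
  have hx2 : x ∈ interior σ₂ := by
    by_contra hx2
    exact hB2 x (hco2.isClosed.frontier_eq ▸ ⟨hx, hx2⟩) hx1
  have hpre1 : IsPreconnected (f '' interior σ₁) :=
    hcv1.interior.isPreconnected.image f (hc1.mono interior_subset)
  have hpre2 : IsPreconnected (f '' interior σ₂) :=
    hcv2.interior.isPreconnected.image f (hc2.mono interior_subset)
  have hUV : f '' interior σ₁ = f '' interior σ₂ := by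
    apply subset_antisymm
    · refine hpre1.subset_of_disjoint_frontier ⟨f x, hx1, x, hx2, rfl⟩ ?_
      rw [hf2, Set.disjoint_right]
      rintro _ ⟨y, hy, rfl⟩
      exact hB2 y hy
    · refine hpre2.subset_of_disjoint_frontier ⟨f x, ⟨x, hx2, rfl⟩, hx1⟩ ?_
      rw [hf1, Set.disjoint_right]
      rintro _ ⟨y, hy, rfl⟩
      exact hB1 y hy
  have hfr : frontier σ₁ = frontier σ₂ := by
    rw [← hib.image_eq_image_iff subset_union_left subset_union_right, ← hf1, ← hf2, hUV]
  have hsub : σ₁ ⊆ σ₂ := by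
    conv_lhs => rw [hσ₁]
    refine convexHull_min ?_ hcv2
    refine Subset.trans ?_ hco2.isClosed.frontier_subset
    rw [← hfr, hσ₁]
    exact vertex h1
  obtain ⟨y, hy⟩ := hne1
  exact hd1 y (hsub (interior_subset hy)) hy

end
end

section
/- Let Ω ⊂ ℝ² be a closed polygon, and let 0 < α ≤ 1, A₀, A₁, A₂ > 0, a₀ ≥ 0, and a₁ ≥ a₂ be real numbers. Then there exists c₃ > 0 such that for every ε > 0, every triangulation K of Ω satisfying sin φ ≥ A₀ ε^{a₀} for every angle φ of every triangular face of K and A₁ ε^{a₁} ≤ |e| ≤ A₂ ε^{a₂} for every edge e of K, and every continuous u : Ω → ℝ² that is piecewise affine over K, one has |u|_α ≤ c₃ · ‖u‖_∞ · ε^{−α(a₀ + a₁)}. -/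
open Set Geometry EuclideanGeometry Metric Real

noncomputable section

theorem le_mul_rpow_of_le_of_le_mul {d B τ α : ℝ} (hB : 0 ≤ B) (hτ : 0 < τ) (hα0 : 0 < α)
    (hα1 : α ≤ 1) (h1 : d ≤ B) (h2 : d ≤ B * τ) : d ≤ B * τ ^ α := by
  rcases le_total τ 1 with h | h
  · refine h2.trans (mul_le_mul_of_nonneg_left ?_ hB)
    simpa using Real.rpow_le_rpow_of_exponent_ge hτ h hα1
  · exact h1.trans (le_mul_of_one_le_right hB (Real.one_le_rpow h hα0.le))

theorem norm_sub_le_of_segment_subset_biUnion {E F ι : Type*} [NormedAddCommGroup E]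
    [NormedSpace ℝ E] [NormedAddCommGroup F] {I : Set ι} (hI : I.Finite) {C : ι → Set E}
    (hC : ∀ i ∈ I, IsClosed (C i)) {u : E → F} {L : ℝ}
    (hL : ∀ i ∈ I, ∀ x ∈ C i, ∀ y ∈ C i, ‖u x - u y‖ ≤ L * ‖x - y‖) {x y : E}
    (hu : ContinuousOn u (segment ℝ x y)) (hxy : segment ℝ x y ⊆ ⋃ i ∈ I, C i) :
    ‖u x - u y‖ ≤ L * ‖x - y‖ := by
  set γ : ℝ → E := fun t => AffineMap.lineMap x y t with hγ
  have hγc : Continuous γ := AffineMap.lineMap_continuous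
  have hmem : ∀ t ∈ Icc (0 : ℝ) 1, γ t ∈ segment ℝ x y := fun t ht => by
    rw [segment_eq_image_lineMap]; exact ⟨t, ht, rfl⟩
  have hdist : ∀ t t', ‖γ t - γ t'‖ = |t - t'| * ‖x - y‖ := fun t t' => by
    rw [← dist_eq_norm, ← dist_eq_norm, dist_lineMap_lineMap, Real.dist_eq]
  set S : Set ℝ := {t | ‖u (γ 0) - u (γ t)‖ ≤ L * (t * ‖x - y‖)} with hS
  have hcont : ContinuousOn (fun t => u (γ t)) (Icc 0 1) := hu.comp hγc.continuousOn hmem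
  have hclosed : IsClosed (S ∩ Icc 0 1) := by
    have : S ∩ Icc 0 1 =
        {t ∈ Icc (0 : ℝ) 1 | ‖u (γ 0) - u (γ t)‖ ≤ L * (t * ‖x - y‖)} := by
      ext t; simp [hS, and_comm]
    rw [this]
    exact isClosed_Icc.isClosed_le (continuousOn_const.sub hcont).norm (by fun_prop)
  have key : Icc (0 : ℝ) 1 ⊆ S := by
    refine hclosed.Icc_subset_of_forall_exists_gt (by simp [hS]) ?_
    rintro t ⟨htS, ht0, ht1⟩ b (hb : t < b)
    have hnear : ∀ᶠ t' in nhds t, ∀ i ∈ I, γ t ∉ C i → γ t' ∉ C i := by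
      rw [Filter.eventually_all_finite hI]
      intro i hi
      by_cases h : γ t ∈ C i
      · simp [h]
      · filter_upwards [hγc.continuousAt.eventually ((hC i hi).isOpen_compl.mem_nhds h)]
          with t' ht' _ using ht'
    have hright : ∀ᶠ t' in nhdsWithin t (Ioi t), t' ∈ Ioc t (min b 1) :=
      Ioc_mem_nhdsGT (lt_min hb ht1)
    obtain ⟨t', h1, h2⟩ := ((hnear.filter_mono nhdsWithin_le_nhds).and hright).exists
    have ht'1 : t' ≤ 1 := h2.2.trans (min_le_right _ _)
    obtain ⟨i, hi, hti⟩ := mem_iUnion₂.1 (hxy (hmem t' ⟨ht0.trans h2.1.le, ht'1⟩))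
    have hti' : γ t ∈ C i := by
      by_contra h
      exact h1 i hi h hti
    refine ⟨t', ?_, h2.1, h2.2.trans (min_le_left _ _)⟩
    have h3 := hL i hi _ hti' _ hti
    rw [hdist, abs_sub_comm, abs_of_pos (sub_pos.2 h2.1)] at h3
    have h4 : ‖u (γ 0) - u (γ t')‖ ≤ ‖u (γ 0) - u (γ t)‖ + ‖u (γ t) - u (γ t')‖ :=
      norm_sub_le_norm_sub_add_norm_sub _ _ _
    have h5 : ‖u (γ 0) - u (γ t)‖ ≤ L * (t * ‖x - y‖) := htS
    change ‖u (γ 0) - u (γ t')‖ ≤ L * (t' * ‖x - y‖)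
    linarith
  have := key (right_mem_Icc.2 zero_le_one)
  simpa [hS, hγ] using this

theorem AffineIndependent.weight_eq_zero_of_mem_convexHull {E : Type*} [AddCommGroup E]
    [Module ℝ E] {s f : Finset E} (hs : AffineIndependent ℝ ((↑) : s → E)) (hf : f ⊆ s)
    {w : E → ℝ} (hw : ∑ v ∈ s, w v = 1)
    (hx : ∑ v ∈ s, w v • v ∈ convexHull ℝ (f : Set E)) : ∀ v ∈ s, v ∉ f → w v = 0 := by
  classical
  obtain ⟨d, -, hd1, hdx⟩ := Finset.mem_convexHull'.1 hx
  have := hs.eq_zero_of_sum_eq_zero_subtype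
    (w := fun v => w v - if v ∈ f then d v else 0) ?_ ?_
  · intro v hv hvf
    simpa [hvf] using this v hv
  · simp [Finset.inter_eq_right.2 hf, hw, hd1]
  · simp only [sub_smul, ite_smul, zero_smul, Finset.sum_sub_distrib, Finset.sum_ite_mem,
      Finset.inter_eq_right.2 hf, hdx, sub_self]

theorem sum_ite_mem_eq_sdiff_add_inter {E M : Type*} [DecidableEq E] [AddCommMonoid M]
    (s t : Finset E)
    (f g : E → M) :
    ∑ v ∈ s, (if v ∈ t then g v else f v) = ∑ v ∈ s \ t, f v + ∑ v ∈ s ∩ t, g v := by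
  rw [← Finset.sum_inter_add_sum_sdiff s t, add_comm]
  congr 1
  · exact Finset.sum_congr rfl fun v hv => if_neg (Finset.mem_sdiff.1 hv).2
  · exact Finset.sum_congr rfl fun v hv => if_pos (Finset.mem_inter.1 hv).2

theorem exists_mem_convexHull_smul_eq_sum {E : Type*} [AddCommGroup E] [Module ℝ E]
    {s : Finset E} (hs : s.Nonempty) {w : E → ℝ} (hw : ∀ v ∈ s, 0 ≤ w v) :
    ∃ p ∈ convexHull ℝ (s : Set E), (∑ v ∈ s, w v) • p = ∑ v ∈ s, w v • v := by
  rcases (Finset.sum_nonneg hw).eq_or_lt' with h0 | hpos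
  · obtain ⟨p, hp⟩ := hs
    refine ⟨p, subset_convexHull ℝ _ hp, ?_⟩
    rw [h0, zero_smul, Finset.sum_eq_zero fun v hv => ?_]
    rw [(Finset.sum_eq_zero_iff_of_nonneg hw).1 h0 v hv, zero_smul]
  · refine ⟨s.centerMass w id, s.centerMass_id_mem_convexHull hw hpos, ?_⟩
    simp [Finset.centerMass, smul_smul, hpos.ne']

section Faces

variable {E : Type*} [NormedAddCommGroup E] [NormedSpace ℝ E] [DecidableEq E]
  {K : SimplicialComplex ℝ E} {s t : Finset E}

theorem weight_eq_zero_of_sum_smul_eq (hs : s ∈ K.faces) (ht : t ∈ K.faces) {a b : E → ℝ}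
    (ha : ∀ v ∈ s, 0 ≤ a v) (hb : ∀ v ∈ t, 0 ≤ b v) (h : ∑ v ∈ s, a v = ∑ v ∈ t, b v)
    (hv : ∑ v ∈ s, a v • v = ∑ v ∈ t, b v • v) : ∀ v ∈ s \ t, a v = 0 := by
  rcases (Finset.sum_nonneg ha).eq_or_lt' with h0 | hpos
  · intro v hv
    exact (Finset.sum_eq_zero_iff_of_nonneg ha).1 h0 v (Finset.mem_sdiff.1 hv).1
  set N := ∑ v ∈ s, a v
  have hN1 : ∑ v ∈ s, a v / N = 1 := by rw [← Finset.sum_div, div_self hpos.ne']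
  have hN2 : ∑ v ∈ t, b v / N = 1 := by rw [← Finset.sum_div, ← h, div_self hpos.ne']
  have hx1 : ∑ v ∈ s, (a v / N) • v = N⁻¹ • ∑ v ∈ s, a v • v := by
    simp [Finset.smul_sum, smul_smul, div_eq_inv_mul]
  have hx2 : ∑ v ∈ t, (b v / N) • v = N⁻¹ • ∑ v ∈ s, a v • v := by
    simp [hv, Finset.smul_sum, smul_smul, div_eq_inv_mul]
  have hmem : ∑ v ∈ s, (a v / N) • v ∈ convexHull ℝ ((s ∩ t : Finset E) : Set E) := by
    rw [Finset.coe_inter]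
    refine K.inter_subset_convexHull hs ht ⟨?_, ?_⟩
    · exact Finset.mem_convexHull'.2 ⟨_, fun v hv => div_nonneg (ha v hv) hpos.le, hN1, rfl⟩
    · exact Finset.mem_convexHull'.2
        ⟨_, fun v hv => div_nonneg (hb v hv) hpos.le, hN2, hx2.trans hx1.symm⟩
  intro v hv
  rw [Finset.mem_sdiff] at hv
  have := (K.indep hs).weight_eq_zero_of_mem_convexHull Finset.inter_subset_left hN1 hmem v hv.1
    (by simp [hv.2])
  simpa [hpos.ne'] using this

theorem weight_eq_zero_of_sdiff_sum_smul_eq (hs : s ∈ K.faces) (ht : t ∈ K.faces)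
    {a b c : E → ℝ} (ha : ∀ v ∈ s \ t, 0 ≤ a v) (hb : ∀ v ∈ t \ s, 0 ≤ b v)
    (h : ∑ v ∈ s \ t, a v - ∑ v ∈ t \ s, b v = ∑ v ∈ s ∩ t, c v)
    (hv : ∑ v ∈ s \ t, a v • v - ∑ v ∈ t \ s, b v • v = ∑ v ∈ s ∩ t, c v • v) :
    ∀ v ∈ s \ t, a v = 0 := by
  have hc : ∀ v, c v = max (c v) 0 - max (-c v) 0 := fun v => by
    rcases le_total 0 (c v) with h | h <;> simp [h]
  have hsum : ∑ v ∈ s ∩ t, c v = ∑ v ∈ s ∩ t, max (c v) 0 - ∑ v ∈ s ∩ t, max (-c v) 0 := by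
    rw [← Finset.sum_sub_distrib]; exact Finset.sum_congr rfl fun v _ => hc v
  have hsumv : ∑ v ∈ s ∩ t, c v • v =
      ∑ v ∈ s ∩ t, max (c v) 0 • v - ∑ v ∈ s ∩ t, max (-c v) 0 • v := by
    rw [← Finset.sum_sub_distrib]
    exact Finset.sum_congr rfl fun v _ => by rw [← sub_smul, ← hc v]
  rw [hsum, sub_eq_sub_iff_add_eq_add] at h
  rw [hsumv, sub_eq_sub_iff_add_eq_add] at hv
  have := weight_eq_zero_of_sum_smul_eq hs ht
    (a := fun v => if v ∈ t then max (-c v) 0 else a v)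
    (b := fun v => if v ∈ s then max (c v) 0 else b v) ?_ ?_ ?_ ?_
  · intro v hv
    simpa [(Finset.mem_sdiff.1 hv).2] using this v hv
  · intro v hv
    split_ifs with hvt
    · exact le_max_right _ _
    · exact ha v (by simp [hv, hvt])
  · intro v hv
    split_ifs with hvt
    · exact le_max_right _ _
    · exact hb v (by simp [hv, hvt])
  · rw [sum_ite_mem_eq_sdiff_add_inter, sum_ite_mem_eq_sdiff_add_inter, Finset.inter_comm t s, h,
      add_comm]
  · simp only [ite_smul]
    rw [sum_ite_mem_eq_sdiff_add_inter, sum_ite_mem_eq_sdiff_add_inter, Finset.inter_comm t s, hv,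
      add_comm]

theorem exists_pos_mul_sum_sdiff_le (hs : s ∈ K.faces) (ht : t ∈ K.faces)
    (hst : (s \ t).Nonempty) (hts : (t \ s).Nonempty) :
    ∃ δ > (0 : ℝ), ∀ a b : E → ℝ, (∀ v ∈ s, 0 ≤ a v) → (∀ v ∈ t, 0 ≤ b v) →
      ∑ v ∈ s, a v = 1 → ∑ v ∈ t, b v = 1 →
      δ * ∑ v ∈ s \ t, a v ≤ ‖∑ v ∈ s, a v • v - ∑ v ∈ t, b v • v‖ := by
  set P : Set (E × ℝ) := (fun z : ℝ × E × E =>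
    z.1 • ((z.2.1, 1) : E × ℝ) - (1 - z.1) • ((z.2.2, 1) : E × ℝ)) ''
      (Icc (0 : ℝ) 1 ×ˢ convexHull ℝ ((s \ t : Finset E) : Set E) ×ˢ
        convexHull ℝ ((t \ s : Finset E) : Set E)) with hP
  set W : Submodule ℝ (E × ℝ) :=
    Submodule.span ℝ ((fun v : E => ((v, 1) : E × ℝ)) '' ((s ∩ t : Finset E) : Set E)) with hW
  have hPc : IsCompact P := by
    refine IsCompact.image (isCompact_Icc.prod ?_) (by fun_prop)
    exact ((s \ t).finite_toSet.isCompact_convexHull ℝ).prod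
      ((t \ s).finite_toSet.isCompact_convexHull ℝ)
  have : FiniteDimensional ℝ W :=
    FiniteDimensional.span_of_finite ℝ ((s ∩ t).finite_toSet.image _)
  have hWc : IsClosed (W : Set (E × ℝ)) := W.closed_of_finiteDimensional
  have hdisj : Disjoint P W := by
    rw [Set.disjoint_left]
    rintro _ ⟨⟨θ, p, q⟩, ⟨hθ, hp, hq⟩, rfl⟩ hmem
    obtain ⟨c, hc⟩ := (Submodule.mem_span_image_finset_iff_exists_fun' ℝ).1 hmem
    obtain ⟨a, ha, ha1, rfl⟩ := Finset.mem_convexHull'.1 hp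
    obtain ⟨b, hb, hb1, rfl⟩ := Finset.mem_convexHull'.1 hq
    have hc1 := congrArg Prod.fst hc
    have hc2 := congrArg Prod.snd hc
    simp only [Prod.fst_sum, Prod.snd_sum, Prod.smul_fst, Prod.smul_snd, Prod.fst_sub,
      Prod.snd_sub, smul_eq_mul, mul_one] at hc1 hc2
    have h1 := weight_eq_zero_of_sdiff_sum_smul_eq hs ht
      (a := fun v => θ * a v) (b := fun v => (1 - θ) * b v) (c := c)
      (fun v hv => mul_nonneg hθ.1 (ha v hv))
      (fun v hv => mul_nonneg (sub_nonneg.2 hθ.2) (hb v hv))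
      (by rw [← Finset.mul_sum, ← Finset.mul_sum, ha1, hb1, hc2]; ring)
      (by simp_rw [mul_smul]; rw [← Finset.smul_sum, ← Finset.smul_sum, hc1])
    have h2 := weight_eq_zero_of_sdiff_sum_smul_eq ht hs
      (a := fun v => (1 - θ) * b v) (b := fun v => θ * a v) (c := fun v => - c v)
      (fun v hv => mul_nonneg (sub_nonneg.2 hθ.2) (hb v hv))
      (fun v hv => mul_nonneg hθ.1 (ha v hv))
      (by rw [← Finset.mul_sum, ← Finset.mul_sum, ha1, hb1, Finset.sum_neg_distrib,
            Finset.inter_comm, hc2]; ring)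
      (by simp_rw [mul_smul, neg_smul]
          rw [← Finset.smul_sum, ← Finset.smul_sum, Finset.sum_neg_distrib,
            Finset.inter_comm, hc1, neg_sub])
    have h3 : θ = 0 := by
      have := Finset.sum_eq_zero h1
      rwa [← Finset.mul_sum, ha1, mul_one] at this
    have h4 : 1 - θ = 0 := by
      have := Finset.sum_eq_zero h2
      rwa [← Finset.mul_sum, hb1, mul_one] at this
    linarith
  obtain ⟨δ, hδ, hlt⟩ := Metric.exists_pos_forall_lt_edist hPc hWc hdisj
  refine ⟨δ, hδ, fun a b ha hb ha1 hb1 => ?_⟩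
  set A := ∑ v ∈ s \ t, a v with hA
  set B := ∑ v ∈ t \ s, b v with hB
  have ha' : ∀ v ∈ s \ t, 0 ≤ a v := fun v hv => ha v (Finset.mem_sdiff.1 hv).1
  have hb' : ∀ v ∈ t \ s, 0 ≤ b v := fun v hv => hb v (Finset.mem_sdiff.1 hv).1
  have hA0 : 0 ≤ A := Finset.sum_nonneg ha'
  have hB0 : 0 ≤ B := Finset.sum_nonneg hb'
  rcases hA0.eq_or_lt' with h0 | hApos
  · rw [h0, mul_zero]; exact norm_nonneg _
  obtain ⟨p, hp, hpe⟩ := exists_mem_convexHull_smul_eq_sum hst ha'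
  obtain ⟨q, hq, hqe⟩ := exists_mem_convexHull_smul_eq_sum hts hb'
  have hABpos : 0 < A + B := by linarith
  set w : E × ℝ := ∑ v ∈ s ∩ t, ((A + B)⁻¹ * (b v - a v)) • ((v, 1) : E × ℝ) with hw
  have hwW : w ∈ W := Submodule.sum_mem _ fun v hv =>
    Submodule.smul_mem _ _ (Submodule.subset_span ⟨v, hv, rfl⟩)
  have h1θ : 1 - A / (A + B) = B / (A + B) := by field_simp; ring
  have hzP : (A / (A + B)) • ((p, 1) : E × ℝ) - (1 - A / (A + B)) • ((q, 1) : E × ℝ) ∈ P :=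
    ⟨(A / (A + B), p, q), ⟨⟨by positivity, by rw [div_le_one hABpos]; linarith⟩, hp, hq⟩, rfl⟩
  have hd := hlt _ hzP _ hwW
  have hsa := Finset.sum_inter_add_sum_sdiff s t a
  have hsb := Finset.sum_inter_add_sum_sdiff t s b
  have hsav := Finset.sum_inter_add_sum_sdiff s t (fun v => a v • v)
  have hsbv := Finset.sum_inter_add_sum_sdiff t s (fun v => b v • v)
  rw [Finset.inter_comm] at hsb hsbv
  have heq : (A / (A + B)) • ((p, 1) : E × ℝ) - (1 - A / (A + B)) • ((q, 1) : E × ℝ) - w =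
      (A + B)⁻¹ • ((∑ v ∈ s, a v • v - ∑ v ∈ t, b v • v, 0) : E × ℝ) := by
    rw [h1θ, hw]
    simp_rw [div_eq_inv_mul, mul_smul]
    rw [← Finset.smul_sum, ← smul_sub, ← smul_sub]
    congr 1
    ext1
    · simp only [Prod.fst_sub, Prod.smul_fst, Prod.fst_sum, hA, hB, hpe, hqe, sub_smul,
        Finset.sum_sub_distrib, ← hsav, ← hsbv]
      abel
    · simp only [Prod.snd_sub, Prod.smul_snd, Prod.snd_sum, smul_eq_mul, mul_one,
        Finset.sum_sub_distrib]
      linarith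
  have hd' : (δ : ℝ) < (A + B)⁻¹ * ‖∑ v ∈ s, a v • v - ∑ v ∈ t, b v • v‖ := by
    have : (δ : ℝ) < dist ((A / (A + B)) • ((p, 1) : E × ℝ) -
        (1 - A / (A + B)) • ((q, 1) : E × ℝ)) w := by
      rw [edist_nndist] at hd
      exact_mod_cast hd
    rw [dist_eq_norm, heq, norm_smul, Real.norm_of_nonneg (by positivity)] at this
    simpa [Prod.norm_def] using this
  rw [inv_mul_eq_div, lt_div_iff₀ hABpos] at hd'
  have : (δ : ℝ) * A ≤ δ * (A + B) := mul_le_mul_of_nonneg_left (by linarith) δ.2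
  linarith

theorem exists_inter_point_or_dist_bound (hs : s ∈ K.faces) (ht : t ∈ K.faces) :
    ∃ C : ℝ, 0 ≤ C ∧ ∀ x ∈ convexHull ℝ (s : Set E), ∀ y ∈ convexHull ℝ (t : Set E),
      1 ≤ C * ‖x - y‖ ∨ ∃ z ∈ convexHull ℝ (s : Set E), z ∈ convexHull ℝ (t : Set E) ∧
        ‖x - z‖ ≤ C * ‖x - y‖ := by
  rcases (s \ t).eq_empty_or_nonempty with hst | hst
  · refine ⟨0, le_rfl, fun x hx y _ => Or.inr ⟨x, hx, ?_, by simp⟩⟩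
    exact convexHull_mono (Finset.coe_subset.2 (Finset.sdiff_eq_empty_iff_subset.1 hst)) hx
  rcases (t \ s).eq_empty_or_nonempty with hts | hts
  · refine ⟨1, zero_le_one, fun x _ y hy => Or.inr ⟨y, ?_, hy, by simp⟩⟩
    exact convexHull_mono (Finset.coe_subset.2 (Finset.sdiff_eq_empty_iff_subset.1 hts)) hy
  obtain ⟨δ, hδ, hle⟩ := exists_pos_mul_sum_sdiff_le hs ht hst hts
  rcases (s ∩ t).eq_empty_or_nonempty with hf | ⟨v₀, hv₀⟩
  · refine ⟨δ⁻¹, by positivity, fun x hx y hy => Or.inl ?_⟩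
    obtain ⟨a, ha, ha1, rfl⟩ := Finset.mem_convexHull'.1 hx
    obtain ⟨b, hb, hb1, rfl⟩ := Finset.mem_convexHull'.1 hy
    have := hle a b ha hb ha1 hb1
    rw [Finset.sdiff_eq_self_of_disjoint (Finset.disjoint_iff_inter_eq_empty.2 hf), ha1] at this
    rw [inv_mul_eq_div, one_le_div hδ]
    linarith
  · have hd0 : 0 ≤ Metric.diam (s : Set E) := Metric.diam_nonneg
    refine ⟨Metric.diam (s : Set E) * δ⁻¹, by positivity, fun x hx y hy => Or.inr ?_⟩
    obtain ⟨a, ha, ha1, rfl⟩ := Finset.mem_convexHull'.1 hx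
    obtain ⟨b, hb, hb1, rfl⟩ := Finset.mem_convexHull'.1 hy
    have h1 := hle a b ha hb ha1 hb1
    have hsa := Finset.sum_inter_add_sum_sdiff s t a
    have hsav := Finset.sum_inter_add_sum_sdiff s t (fun v => a v • v)
    set A := ∑ v ∈ s \ t, a v with hA
    have hA0 : 0 ≤ A := Finset.sum_nonneg fun v hv => ha v (Finset.mem_sdiff.1 hv).1
    have hz : ∑ v ∈ s ∩ t, a v • v + A • v₀ ∈ convexHull ℝ ((s ∩ t : Finset E) : Set E) := by
      refine Finset.mem_convexHull'.2 ⟨fun v => a v + if v = v₀ then A else 0, ?_, ?_, ?_⟩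
      · intro v hv
        dsimp only
        have := ha v (Finset.mem_inter.1 hv).1
        split_ifs <;> linarith
      · rw [Finset.sum_add_distrib, Finset.sum_ite_eq', if_pos hv₀, hsa, ha1]
      · simp only [add_smul, ite_smul, zero_smul, Finset.sum_add_distrib]
        rw [Finset.sum_ite_eq', if_pos hv₀]
    refine ⟨_, convexHull_mono (by simp) hz, convexHull_mono (by simp) hz, ?_⟩
    have hxz : ∑ v ∈ s, a v • v - (∑ v ∈ s ∩ t, a v • v + A • v₀) =
        ∑ v ∈ s \ t, a v • (v - v₀) := by
      simp only [smul_sub, Finset.sum_sub_distrib, ← Finset.sum_smul, ← hsav, ← hA]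
      abel
    rw [hxz]
    calc ‖∑ v ∈ s \ t, a v • (v - v₀)‖ ≤ ∑ v ∈ s \ t, a v * Metric.diam (s : Set E) := by
          refine norm_sum_le_of_le _ fun v hv => ?_
          have hvs := (Finset.mem_sdiff.1 hv).1
          rw [norm_smul, Real.norm_of_nonneg (ha v hvs), ← dist_eq_norm]
          exact mul_le_mul_of_nonneg_left (Metric.dist_le_diam_of_mem
            s.finite_toSet.isBounded hvs (Finset.mem_inter.1 hv₀).1) (ha v hvs)
      _ = Metric.diam (s : Set E) * A := by rw [← Finset.sum_mul, mul_comm]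
      _ ≤ _ := by
        rw [mul_assoc]
        refine mul_le_mul_of_nonneg_left ?_ hd0
        rw [inv_mul_eq_div, le_div_iff₀ hδ]
        linarith

end Faces

theorem IsTriangulation.exists_segment_bound {K : SimplicialComplex ℝ E2} {Ω : Set E2}
    (hK : IsTriangulation K Ω) :
    ∃ C : ℝ, 0 ≤ C ∧ ∀ x ∈ Ω, ∀ y ∈ Ω, 1 ≤ C * ‖x - y‖ ∨
      ∃ z, segment ℝ x z ⊆ Ω ∧ segment ℝ z y ⊆ Ω ∧ ‖x - z‖ ≤ C * ‖x - y‖ := by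
  classical
  obtain ⟨hfin, -, rfl, -⟩ := hK
  choose! c hc0 hc using fun (s : Finset E2) (hs : s ∈ K.faces) (t : Finset E2)
    (ht : t ∈ K.faces) => exists_inter_point_or_dist_bound hs ht
  have hnn : ∀ s ∈ hfin.toFinset, ∀ t ∈ hfin.toFinset, 0 ≤ c s t := fun s hs t ht =>
    hc0 s (hfin.mem_toFinset.1 hs) t (hfin.mem_toFinset.1 ht)
  refine ⟨∑ s ∈ hfin.toFinset, ∑ t ∈ hfin.toFinset, c s t,
    Finset.sum_nonneg fun s hs => Finset.sum_nonneg (hnn s hs), fun x hx y hy => ?_⟩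
  obtain ⟨s, hs, hxs⟩ := SimplicialComplex.mem_space_iff.1 hx
  obtain ⟨t, ht, hyt⟩ := SimplicialComplex.mem_space_iff.1 hy
  have hle : c s t ≤ ∑ s ∈ hfin.toFinset, ∑ t ∈ hfin.toFinset, c s t :=
    (Finset.single_le_sum (hnn s (hfin.mem_toFinset.2 hs)) (hfin.mem_toFinset.2 ht)).trans
      (Finset.single_le_sum (f := fun s => ∑ t ∈ hfin.toFinset, c s t)
        (fun s hs => Finset.sum_nonneg (hnn s hs)) (hfin.mem_toFinset.2 hs))
  have hle' := mul_le_mul_of_nonneg_right hle (norm_nonneg (x - y))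
  rcases hc s hs t ht x hxs y hyt with h | ⟨z, hzs, hzt, hz⟩
  · exact Or.inl (h.trans hle')
  · exact Or.inr ⟨z,
      ((convex_convexHull ℝ _).segment_subset hxs hzs).trans
        (SimplicialComplex.convexHull_subset_space hs),
      ((convex_convexHull ℝ _).segment_subset hzt hyt).trans
        (SimplicialComplex.convexHull_subset_space ht), hz.trans hle'⟩

theorem abs_mul_norm_mul_sin_angle_le {V : Type*} [NormedAddCommGroup V] [InnerProductSpace ℝ V]
    (v w : V) (hw : w ≠ 0) (a b : ℝ) :
    |a| * (‖v‖ * Real.sin (InnerProductGeometry.angle v w)) ≤ ‖a • v + b • w‖ := by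
  have hw' : 0 < ‖w‖ := norm_pos_iff.2 hw
  refine le_of_mul_le_mul_right ?_ hw'
  have h := InnerProductGeometry.sin_angle_mul_norm_mul_norm v w
  have : |a| * (‖v‖ * Real.sin (InnerProductGeometry.angle v w)) * ‖w‖ =
      √(a ^ 2 * (inner ℝ v v * inner ℝ w w - inner ℝ v w * inner ℝ v w)) := by
    rw [Real.sqrt_mul (sq_nonneg a), Real.sqrt_sq_eq_abs, ← h]
    ring
  rw [this]
  refine Real.sqrt_le_iff.2 ⟨by positivity, ?_⟩
  rw [mul_pow, ← real_inner_self_eq_norm_sq, ← real_inner_self_eq_norm_sq]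
  simp only [inner_add_left, inner_add_right, real_inner_smul_left, real_inner_smul_right,
    real_inner_comm v w]
  nlinarith [sq_nonneg (a * inner ℝ v w + b * inner ℝ w w)]

theorem norm_sub_le_on_triangle {V F : Type*} [NormedAddCommGroup V] [InnerProductSpace ℝ V]
    [NormedAddCommGroup F] [NormedSpace ℝ F] (A : V →ᵃ[ℝ] F) {p q r : V} {M h σ : ℝ} (hh : 0 < h)
    (hσ : 0 < σ) (hp : ‖A p‖ ≤ M) (hq : ‖A q‖ ≤ M) (hr : ‖A r‖ ≤ M) (hpq : h ≤ dist q p)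
    (hpr : h ≤ dist r p) (hangle : σ ≤ Real.sin (∠ q p r)) {x y : V}
    (hx : x ∈ convexHull ℝ {p, q, r}) (hy : y ∈ convexHull ℝ {p, q, r}) :
    ‖A x - A y‖ ≤ 4 * M / (σ * h) * ‖x - y‖ := by
  have hcoord : ∀ z ∈ convexHull ℝ {p, q, r}, ∃ a b : ℝ, z = p + a • (q - p) + b • (r - p) := by
    intro z hz
    rw [convexHull_insert (by simp), convexHull_pair] at hz
    obtain ⟨_, rfl, z', hz', hz⟩ := mem_convexJoin.1 hz
    rw [segment_eq_image_lineMap] at hz hz'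
    obtain ⟨b, -, rfl⟩ := hz'
    obtain ⟨a, -, rfl⟩ := hz
    refine ⟨a * (1 - b), a * b, ?_⟩
    simp only [AffineMap.lineMap_apply_module]
    module
  obtain ⟨a, b, rfl⟩ := hcoord x hx
  obtain ⟨a', b', rfl⟩ := hcoord y hy
  have hq0 : q - p ≠ 0 := norm_pos_iff.1 (by rw [← dist_eq_norm]; linarith)
  have hr0 : r - p ≠ 0 := norm_pos_iff.1 (by rw [← dist_eq_norm]; linarith)
  set N := ‖(a - a') • (q - p) + (b - b') • (r - p)‖ with hN
  have hdiff : p + a • (q - p) + b • (r - p) - (p + a' • (q - p) + b' • (r - p)) =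
      (a - a') • (q - p) + (b - b') • (r - p) := by module
  have hσh : 0 < σ * h := mul_pos hσ hh
  have hang : σ ≤ Real.sin (InnerProductGeometry.angle (q - p) (r - p)) := hangle
  have ha : |a - a'| * (σ * h) ≤ N := by
    refine le_trans ?_ (abs_mul_norm_mul_sin_angle_le (q - p) (r - p) hr0 (a - a') (b - b'))
    rw [← dist_eq_norm, mul_comm σ]
    gcongr
  have hb : |b - b'| * (σ * h) ≤ N := by
    have := abs_mul_norm_mul_sin_angle_le (r - p) (q - p) hq0 (b - b') (a - a')
    rw [add_comm, InnerProductGeometry.angle_comm] at this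
    refine le_trans ?_ this
    rw [← dist_eq_norm r, mul_comm σ]
    gcongr
  have hAdiff : A (p + a • (q - p) + b • (r - p)) - A (p + a' • (q - p) + b' • (r - p)) =
      (a - a') • (A q - A p) + (b - b') • (A r - A p) := by
    rw [← vsub_eq_sub (A _) (A _), ← A.linearMap_vsub, vsub_eq_sub, hdiff, map_add, map_smul,
      map_smul, ← vsub_eq_sub q, ← vsub_eq_sub r, A.linearMap_vsub, A.linearMap_vsub,
      vsub_eq_sub, vsub_eq_sub]
  rw [hAdiff, hdiff, ← hN]
  have h1 : ‖A q - A p‖ ≤ 2 * M := (norm_sub_le _ _).trans (by linarith)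
  have h2 : ‖A r - A p‖ ≤ 2 * M := (norm_sub_le _ _).trans (by linarith)
  have hM : 0 ≤ M := (norm_nonneg _).trans hp
  calc ‖(a - a') • (A q - A p) + (b - b') • (A r - A p)‖
      ≤ |a - a'| * (2 * M) + |b - b'| * (2 * M) := by
        refine (norm_add_le _ _).trans ?_
        rw [norm_smul, norm_smul, Real.norm_eq_abs, Real.norm_eq_abs]
        gcongr
    _ ≤ N / (σ * h) * (2 * M) + N / (σ * h) * (2 * M) := by
        gcongr
        · rwa [le_div_iff₀ hσh]
        · rwa [le_div_iff₀ hσh]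
    _ = 4 * M / (σ * h) * N := by ring

theorem IsTriangulation.norm_sub_le_on_face {K : SimplicialComplex ℝ E2} {Ω : Set E2}
    (hK : IsTriangulation K Ω) {σ h M : ℝ} (hσ : 0 < σ) (hh : 0 < h) (hangle : AngleLB K σ)
    (hedge : ∀ e ∈ K.faces, e.card = 2 → h ≤ edgeLen e) {u : E2 → E2}
    (hM : ∀ x ∈ Ω, ‖u x‖ ≤ M) (hu : PiecewiseAffineOn u K) {s : Finset E2} (hs : s ∈ K.faces)
    {x y : E2} (hx : x ∈ convexHull ℝ (s : Set E2)) (hy : y ∈ convexHull ℝ (s : Set E2)) :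
    ‖u x - u y‖ ≤ 4 * M / (σ * h) * ‖x - y‖ := by
  classical
  obtain ⟨-, -, rfl, hpure⟩ := hK
  obtain ⟨t, ht, hst, hcard⟩ := hpure s hs
  have hst' := convexHull_mono (𝕜 := ℝ) (Finset.coe_subset.2 hst)
  obtain ⟨A, hA⟩ := hu t ht
  obtain ⟨p, q, r, hpq, hpr, hqr, rfl⟩ := Finset.card_eq_three.1 hcard
  have hbound : ∀ v ∈ ({p, q, r} : Finset E2), ‖A v‖ ≤ M := fun v hv => by
    rw [← hA v (subset_convexHull ℝ _ hv)]
    exact hM v (SimplicialComplex.subset_space ht hv)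
  have hlen : ∀ v ∈ ({p, q, r} : Finset E2), ∀ w ∈ ({p, q, r} : Finset E2), v ≠ w →
      h ≤ dist v w := fun v hv w hw hvw => by
    have := hedge {v, w} (K.down_closed ht
      (Finset.insert_subset hv (Finset.singleton_subset_iff.2 hw)) (by simp))
      (Finset.card_pair hvw)
    simpa [edgeLen, Metric.diam_pair] using this
  rw [hA x (hst' hx), hA y (hst' hy)]
  have hcoe : ((({p, q, r} : Finset E2)) : Set E2) = {p, q, r} := by simp
  refine norm_sub_le_on_triangle A hh hσ (hbound p (by simp)) (hbound q (by simp))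
    (hbound r (by simp)) (hlen q (by simp) p (by simp) hpq.symm)
    (hlen r (by simp) p (by simp) hpr.symm)
    (hangle _ ht q (by simp) p (by simp) r (by simp) hpq.symm hpr hqr) ?_ ?_
  · exact hcoe ▸ hst' hx
  · exact hcoe ▸ hst' hy

theorem IsTriangulation.mul_le_diam {K : SimplicialComplex ℝ E2} {Ω : Set E2}
    (hK : IsTriangulation K Ω) (hΩ : IsCompact Ω) (hne : Ω.Nonempty) {σ h : ℝ} (hh : 0 < h)
    (hangle : AngleLB K σ) (hedge : ∀ e ∈ K.faces, e.card = 2 → h ≤ edgeLen e) :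
    σ * h ≤ Metric.diam Ω := by
  classical
  obtain ⟨-, -, rfl, hpure⟩ := hK
  obtain ⟨x, hx⟩ := hne
  obtain ⟨s, hs, -⟩ := SimplicialComplex.mem_space_iff.1 hx
  obtain ⟨t, ht, -, hcard⟩ := hpure s hs
  obtain ⟨p, q, r, hpq, hpr, hqr, rfl⟩ := Finset.card_eq_three.1 hcard
  have hpqf : ({p, q} : Finset E2) ∈ K.faces :=
    K.down_closed ht (by intro v; simp; tauto) (by simp)
  have h1 : h ≤ Metric.diam K.space := (hedge _ hpqf (Finset.card_pair hpq)).trans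
    (Metric.diam_mono (SimplicialComplex.subset_space hpqf) hΩ.isBounded)
  have h2 : σ ≤ 1 := (hangle _ ht p (by simp) q (by simp) r (by simp) hpq hqr hpr).trans
    (Real.sin_le_one _)
  exact (mul_le_of_le_one_left hh.le h2).trans h1



/-- a priori bound on the Hölder seminorm of a piecewise affine
function in terms of its supremum norm and the triangulation parameters. -/
theorem statement14 (Ω : Set E2) (hΩ : IsClosedPolygon Ω)
    (α : ℝ) (hα0 : 0 < α) (hα1 : α ≤ 1)
    (A₀ A₁ A₂ : ℝ) (hA₀ : 0 < A₀) (hA₁ : 0 < A₁) (hA₂ : 0 < A₂)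
    (a₀ a₁ a₂ : ℝ) (ha₀ : 0 ≤ a₀) (ha₁₂ : a₂ ≤ a₁) :
    ∃ c₃ > (0 : ℝ), ∀ ε : ℝ, 0 < ε →
      ∀ K : SimplicialComplex ℝ E2, IsTriangulation K Ω →
        AngleLB K (A₀ * ε ^ a₀) →
        (∀ e ∈ K.faces, e.card = 2 →
          A₁ * ε ^ a₁ ≤ edgeLen e ∧ edgeLen e ≤ A₂ * ε ^ a₂) →
      ∀ u : E2 → E2, ContinuousOn u Ω → PiecewiseAffineOn u K →
        holderSeminorm α Ω u ≤ c₃ * supNorm Ω u * ε ^ (-α * (a₀ + a₁)) := by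
  obtain ⟨hcomp, K₀, hK₀⟩ := hΩ
  obtain ⟨C, hC0, hC⟩ := hK₀.exists_segment_bound
  set D := Metric.diam Ω with hD
  have hD0 : 0 ≤ D := Metric.diam_nonneg
  set B : ℝ := 4 * (1 + 2 * C) + 2 * C * D + 2 with hBdef
  have hB2 : 2 ≤ B := by have : 0 ≤ 2 * C * D := by positivity
                         linarith
  refine ⟨B * (A₀ * A₁) ^ (-α), by positivity, ?_⟩
  intro ε hε K hK hangle hedge u hu hpa
  set M := supNorm Ω u with hMdef
  have hM0 : 0 ≤ M := Real.sSup_nonneg (by rintro _ ⟨x, -, rfl⟩; exact norm_nonneg _)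
  have hM : ∀ x ∈ Ω, ‖u x‖ ≤ M := fun x hx =>
    le_csSup (hcomp.bddAbove_image hu.norm) ⟨x, hx, rfl⟩
  set σ := A₀ * ε ^ a₀ with hσdef
  set h := A₁ * ε ^ a₁ with hhdef
  have hσ : 0 < σ := by positivity
  have hh : 0 < h := by positivity
  have hσh : 0 < σ * h := mul_pos hσ hh
  have hedge' : ∀ e ∈ K.faces, e.card = 2 → h ≤ edgeLen e := fun e he hc => (hedge e he hc).1
  have hface : ∀ s ∈ K.faces, ∀ x ∈ convexHull ℝ (s : Set E2),
      ∀ y ∈ convexHull ℝ (s : Set E2), ‖u x - u y‖ ≤ 4 * M / (σ * h) * ‖x - y‖ :=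
    fun s hs x hx y hy => hK.norm_sub_le_on_face hσ hh hangle hedge' hM hpa hs hx hy
  have hseg : ∀ x y, segment ℝ x y ⊆ Ω → ‖u x - u y‖ ≤ 4 * M / (σ * h) * ‖x - y‖ := by
    intro x y hxy
    refine norm_sub_le_of_segment_subset_biUnion hK.1 (fun s _ => ?_) hface (hu.mono hxy) ?_
    · exact s.finite_toSet.isClosed_convexHull ℝ
    · exact hxy.trans hK.2.2.1.ge
  have hscale : (A₀ * A₁) ^ (-α) * ε ^ (-α * (a₀ + a₁)) = (σ * h) ^ (-α) := by
    have : σ * h = A₀ * A₁ * ε ^ (a₀ + a₁) := by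
      rw [hσdef, hhdef, Real.rpow_add hε]; ring
    rw [this, Real.mul_rpow (x := A₀ * A₁) (by positivity) (by positivity), ← Real.rpow_mul hε.le,
      mul_comm (a₀ + a₁)]
  refine Real.sSup_le ?_ (by positivity)
  rintro _ ⟨x, hx, y, hy, hxy, rfl⟩
  have hpos : 0 < ‖x - y‖ := norm_pos_iff.2 (sub_ne_zero.2 hxy)
  set τ := ‖x - y‖ / (σ * h) with hτdef
  have hτ : 0 < τ := by positivity
  have htriv : ‖u x - u y‖ ≤ 2 * M :=
    (norm_sub_le _ _).trans (by linarith [hM x hx, hM y hy])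
  have hlin : ‖u x - u y‖ ≤ B * M * τ := by
    rcases hC x hx y hy with h1 | ⟨z, hxz, hzy, hz⟩
    · have hdiam := hK.mul_le_diam hcomp ⟨x, hx⟩ hh hangle hedge'
      have h2 : 1 ≤ C * D * τ := by
        have : ‖x - y‖ = τ * (σ * h) := by rw [hτdef, div_mul_cancel₀ _ hσh.ne']
        calc 1 ≤ C * ‖x - y‖ := h1
          _ = C * (τ * (σ * h)) := by rw [this]
          _ ≤ C * (τ * D) := by gcongr
          _ = C * D * τ := by ring
      calc ‖u x - u y‖ ≤ 2 * M * 1 := by linarith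
        _ ≤ 2 * M * (C * D * τ) := by gcongr
        _ = 2 * C * D * M * τ := by ring
        _ ≤ B * M * τ := by gcongr; linarith
    · have hzy' : ‖z - y‖ ≤ (1 + C) * ‖x - y‖ := by
        have := norm_sub_le_norm_sub_add_norm_sub z x y
        rw [norm_sub_rev z x] at this
        linarith
      calc ‖u x - u y‖ ≤ ‖u x - u z‖ + ‖u z - u y‖ := norm_sub_le_norm_sub_add_norm_sub _ _ _
        _ ≤ 4 * M / (σ * h) * (C * ‖x - y‖) + 4 * M / (σ * h) * ((1 + C) * ‖x - y‖) := by
          refine add_le_add ((hseg x z hxz).trans ?_) ((hseg z y hzy).trans ?_) <;> gcongr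
        _ = 4 * (1 + 2 * C) * M * τ := by rw [hτdef]; ring
        _ ≤ B * M * τ := by
          gcongr
          have : 0 ≤ 2 * C * D := by positivity
          linarith
  have hmain := le_mul_rpow_of_le_of_le_mul (by positivity) hτ hα0 hα1
    (htriv.trans (by gcongr)) hlin
  rw [div_le_iff₀ (by positivity)]
  refine hmain.trans_eq ?_
  rw [hτdef, Real.div_rpow hpos.le hσh.le, div_eq_mul_inv, ← Real.rpow_neg hσh.le, ← hscale]
  ring

end
end
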